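/- arXiv:1101.4413 — 2 statements merged into one kernel-verified Lean document; each statement's English description precedes it below -/
import Mathlib

section
/- Fix an integer q ≥ 1 and δ > 0. There exist constants C, c > 0 such that for all ρ > 0 and all φ with −π/(4q) + δ < φ < π/(4q) − δ, the entire function F_q(ξ) = ∫_ℝ exp(−2πixξ − x^{2q}) dx satisfies |F_q(ρ e^{iφ})| ≤ C exp(−c ρ^{2q/(2q−1)}). -/
open Real MeasureTheory Complex

/-- `F_q` extended to complex argument:
`F_q(ξ) = ∫ exp(−2πixξ − x^{2q}) dx`. -/
noncomputable def FqC (q : ℕ) (ξ : ℂ) : ℂ :=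
  ∫ x : ℝ, Complex.exp (-(2 * π * Complex.I * x * ξ) - (x : ℂ) ^ (2 * q))

open Filter Topology

lemma path_bound {f G : ℂ → ℂ} (hf : Continuous f) (hG : ∀ z, HasDerivAt G (f z) z)
    (A B : ℂ) (t0 t1 : ℝ) (h01 : t0 ≤ t1) (h : ℝ → ℝ) (hi : IntervalIntegrable h volume t0 t1)
    (hb : ∀ t, t0 ≤ t → t ≤ t1 → ‖f (A + t * B)‖ ≤ h t) :
    ‖G (A + t1 * B) - G (A + t0 * B)‖ ≤ ‖B‖ * ∫ t in t0..t1, h t := by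
  have hd : ∀ t : ℝ, HasDerivAt (fun t : ℝ => G (A + t * B)) (f (A + t * B) * B) t := by
    intro t
    have h1 : HasDerivAt (fun z : ℂ => A + z * B) B (t : ℂ) := by
      simpa using ((hasDerivAt_id (t : ℂ)).mul_const B).const_add A
    have h2 := (hG (A + t * B)).comp (t : ℂ) h1
    exact h2.comp_ofReal
  have hc : Continuous (fun t : ℝ => f (A + t * B) * B) := by fun_prop
  have h3 := intervalIntegral.integral_eq_sub_of_hasDerivAt (a := t0) (b := t1)
    (fun t _ => hd t) (hc.intervalIntegrable _ _)
  rw [← h3, ← intervalIntegral.integral_const_mul]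
  apply intervalIntegral.norm_integral_le_of_norm_le h01 _ (hi.const_mul _)
  refine Eventually.of_forall fun t ht => ?_
  rw [norm_mul, mul_comm]
  exact mul_le_mul_of_nonneg_left (hb t ht.1.le ht.2) (norm_nonneg _)

lemma contour_bound (f : ℂ → ℂ) (hf : Differentiable ℂ f) (T a S : ℝ) (hT : 0 ≤ T) (ha : 0 < a)
    (g : ℝ → ℝ) (hg : Integrable g) (hg0 : ∀ x, 0 ≤ g x) (hge : ∀ x, g (-x) = g x)
    (hseg : ∀ x : ℝ, |x| ≤ a → ‖f (x - (T * a : ℝ) * I)‖ ≤ S)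
    (hray : ∀ x : ℝ, a ≤ |x| → ‖f (x - (T * |x| : ℝ) * I)‖ ≤ g x)
    (v : ℝ → ℝ)
    (hvert : ∀ x : ℝ, a ≤ |x| → ∀ y : ℝ, 0 ≤ y → y ≤ T * |x| → ‖f (x - y * I)‖ ≤ v |x|)
    (hv : Tendsto (fun X => X * v X) atTop (𝓝 0)) :
    ‖∫ x : ℝ, f x‖ ≤ 2 * a * S + 2 * (1 + T) * ∫ x, g x := by
  have hgi : 0 ≤ ∫ x, g x := integral_nonneg hg0
  have hS : 0 ≤ S := (norm_nonneg _).trans (hseg 0 (by simpa using ha.le))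
  by_cases hint : Integrable (fun x : ℝ => f x)
  swap
  · rw [integral_undef hint, norm_zero]; positivity
  obtain ⟨G, hG'⟩ : Complex.IsExactOn f Set.univ :=
    Complex.IsConservativeOn.isExactOn_univ hf.continuous hf.differentiableOn.isConservativeOn
  have hG : ∀ z, HasDerivAt G (f z) z := fun z => hG' z trivial
  have hlim := intervalIntegral_tendsto_integral hint tendsto_neg_atTop_atBot tendsto_id
  have key : ∀ X : ℝ, a ≤ X → ‖∫ x in (-X)..X, f x‖ ≤
      (2 * a * S + 2 * (1 + T) * ∫ x, g x) + 2 * T * (X * v X) := by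
    intro X hX
    have hX0 : 0 < X := ha.trans_le hX
    have e0 : ∫ x in (-X)..X, f x = G X - G (-X : ℝ) := by
      apply intervalIntegral.integral_eq_sub_of_hasDerivAt
      · intro t _
        exact (hG t).comp_ofReal
      · exact hint.intervalIntegrable
    -- vertical
    have vert : ∀ s : ℝ, |s| = 1 → ‖G ((s * X : ℝ) - (T * X : ℝ) * I) - G (s * X : ℝ)‖
        ≤ T * (X * v X) := by
      intro s hs
      have hsX : |s * X| = X := by rw [abs_mul, hs, one_mul, abs_of_pos hX0]
      have := path_bound hf.continuous hG (s * X : ℝ) (-I) 0 (T * X) (by positivity)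
        (fun _ => v X) (by simp) (by
          intro t h0 h1
          have := hvert (s * X) (by rw [hsX]; exact hX) t h0 (by rw [hsX]; exact h1)
          rw [hsX] at this
          convert this using 3
          ring)
      simp only [intervalIntegral.integral_const, norm_neg, norm_I, one_mul, sub_zero,
        smul_eq_mul, ofReal_zero, zero_mul, add_zero] at this
      calc _ = _ := by congr 3; ring
        _ ≤ _ := this
        _ = _ := by ring
    have ray : ∀ s : ℝ, |s| = 1 →
        ‖G ((s * X : ℝ) - (T * X : ℝ) * I) - G ((s * a : ℝ) - (T * a : ℝ) * I)‖
        ≤ (1 + T) * ∫ x, g x := by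
      intro s hs
      have := path_bound hf.continuous hG 0 (s - T * I) a X hX g hg.intervalIntegrable (by
          intro t h0 h1
          have ht : |s * t| = t := by
            rw [abs_mul, hs, one_mul, abs_of_pos (ha.trans_le h0)]
          have := hray (s * t) (by rw [ht]; exact h0)
          rw [ht] at this
          have hgs : g (s * t) = g t := by
            rcases (abs_eq (by norm_num : (0:ℝ) ≤ 1)).1 hs with h | h <;> simp [h, hge]
          rw [hgs] at this
          convert this using 3
          push_cast; ring)
      have hB : ‖(s : ℂ) - T * I‖ ≤ 1 + T := by
        refine (norm_sub_le _ _).trans ?_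
        simp [hs, abs_of_nonneg hT]
      have hI : ∫ x in a..X, g x ≤ ∫ x, g x := by
        rw [intervalIntegral.integral_of_le hX]
        exact setIntegral_le_integral hg (Eventually.of_forall hg0)
      calc _ = _ := by
              congr 3 <;> (push_cast; ring)
        _ ≤ _ := this
        _ ≤ _ := mul_le_mul hB hI (intervalIntegral.integral_nonneg hX fun x _ => hg0 x)
                  (by positivity)
    have seg : ‖G ((a : ℝ) - (T * a : ℝ) * I) - G ((-a : ℝ) - (T * a : ℝ) * I)‖ ≤ 2 * a * S := by
      have := path_bound hf.continuous hG (-(T * a : ℝ) * I) 1 (-a) a (by linarith)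
        (fun _ => S) (by simp) (by
          intro t h0 h1
          have := hseg t (abs_le.2 ⟨h0, h1⟩)
          convert this using 3
          ring)
      simp only [intervalIntegral.integral_const, norm_one, one_mul, smul_eq_mul] at this
      calc _ = _ := by congr 3 <;> ring
        _ ≤ _ := this
        _ = _ := by ring
    have v1 := vert 1 (by simp)
    have v2 := vert (-1) (by simp)
    have r1 := ray 1 (by simp)
    have r2 := ray (-1) (by simp)
    simp only [one_mul, neg_mul] at v1 v2 r1 r2
    rw [e0]
    rw [norm_sub_rev] at v1 r2
    set p1 := G X
    set p2 := G ((X : ℝ) - (T * X : ℝ) * I)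
    set p3 := G ((a : ℝ) - (T * a : ℝ) * I)
    set p4 := G ((-a : ℝ) - (T * a : ℝ) * I)
    set p5 := G ((-X : ℝ) - (T * X : ℝ) * I)
    set p6 := G (-X : ℝ)
    have : p1 - p6 = (p1 - p2) + (p2 - p3) + (p3 - p4) + (p4 - p5) + (p5 - p6) := by ring
    rw [this]
    have n1 := norm_add_le ((p1 - p2) + (p2 - p3) + (p3 - p4) + (p4 - p5)) (p5 - p6)
    have n2 := norm_add_le ((p1 - p2) + (p2 - p3) + (p3 - p4)) (p4 - p5)
    have n3 := norm_add_le ((p1 - p2) + (p2 - p3)) (p3 - p4)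
    have n4 := norm_add_le (p1 - p2) (p2 - p3)
    linarith
  have hlim2 : Tendsto (fun X => (2 * a * S + 2 * (1 + T) * ∫ x, g x) + 2 * T * (X * v X)) atTop
      (𝓝 ((2 * a * S + 2 * (1 + T) * ∫ x, g x) + 2 * T * 0)) :=
    (hv.const_mul _).const_add _
  rw [mul_zero, add_zero] at hlim2
  refine le_of_tendsto_of_tendsto hlim.norm hlim2 ?_
  filter_upwards [eventually_ge_atTop a] with X hX using key X hX

lemma re_pow_bound (q : ℕ) (θ : ℝ) (h0 : 0 ≤ θ) (h1 : 2 * q * θ ≤ π) (h2 : θ < π / 2)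
    (hc : 0 ≤ Real.cos (2 * q * θ))
    (x y : ℝ) (hx : x ≠ 0) (hy : |y| ≤ Real.tan θ * |x|) :
    Real.cos (2 * q * θ) * x ^ (2 * q) ≤ (((x : ℂ) + y * I) ^ (2 * q)).re := by
  wlog hpos : 0 < x generalizing x y
  · have := this (-x) (-y) (by simpa using hx) (by simpa using hy)
      (by
        have : x < 0 := lt_of_le_of_ne (not_lt.1 hpos) hx
        linarith)
    have e : ((-x : ℝ) : ℂ) + (-y : ℝ) * I = -((x : ℂ) + y * I) := by push_cast; ring
    rwa [e, (even_two_mul q).neg_pow, (even_two_mul q).neg_pow] at this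
  set z : ℂ := (x : ℂ) + y * I with hz
  have hre : z.re = x := by simp [hz]
  have him : z.im = y := by simp [hz]
  rw [abs_of_pos hpos] at hy
  have harg : |arg z| ≤ θ := by
    have hlt : |arg z| < π / 2 := abs_arg_lt_pi_div_two_iff.2 (Or.inl (by rw [hre]; exact hpos))
    by_contra hcon
    push Not at hcon
    have ht := Real.tan_lt_tan_of_nonneg_of_lt_pi_div_two h0 hlt hcon
    have ht2 : Real.tan |arg z| = |y| / x := by
      have := Complex.tan_arg z
      rw [hre, him] at this
      rcases abs_choice (arg z) with h | h
      · rw [h, this] 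
        rw [h] at ht
        rw [this] at ht
        have h5 : 0 ≤ Real.tan θ := Real.tan_nonneg_of_nonneg_of_le_pi_div_two h0 h2.le
        have h6 : 0 < y / x := lt_of_le_of_lt h5 ht
        rw [abs_of_pos ((div_pos_iff_of_pos_right hpos).1 h6)]
      · rw [h, Real.tan_neg, this]
        rw [h, Real.tan_neg, this] at ht
        have h5 : 0 ≤ Real.tan θ := Real.tan_nonneg_of_nonneg_of_le_pi_div_two h0 h2.le
        have h6 : 0 < (-y) / x := by rw [neg_div]; exact lt_of_le_of_lt h5 ht
        rw [abs_of_neg (by linarith [(div_pos_iff_of_pos_right hpos).1 h6]), neg_div]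
    rw [ht2, lt_div_iff₀ hpos] at ht
    linarith
  have hp : (z ^ (2 * q)).re = ‖z‖ ^ (2 * q) * Real.cos (2 * q * arg z) := by
    conv_lhs => rw [← norm_mul_exp_arg_mul_I z, mul_pow, ← Complex.exp_nat_mul]
    rw [← ofReal_pow, re_ofReal_mul]
    congr 1
    have : ((2 * q : ℕ) : ℂ) * (arg z * I) = ((2 * q * arg z : ℝ) : ℂ) * I := by push_cast; ring
    rw [this, exp_ofReal_mul_I_re]
  rw [hp, mul_comm]
  have hn : x ≤ ‖z‖ := by rw [← hre]; exact re_le_norm z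
  apply mul_le_mul _ _ hc (by positivity)
  · exact pow_le_pow_left₀ hpos.le hn _
  · rw [← Real.cos_abs (2 * q * arg z)]
    have hq0 : (0:ℝ) ≤ 2 * q := by positivity
    have : |2 * q * arg z| = 2 * q * |arg z| := by rw [abs_mul, abs_of_nonneg hq0]
    rw [this]
    apply Real.cos_le_cos_of_nonneg_of_le_pi (by positivity) h1
    exact mul_le_mul_of_nonneg_left harg hq0

lemma norm_f (q : ℕ) (ρ φ x y : ℝ) :
    ‖Complex.exp (-(2 * π * Complex.I * ((x : ℂ) - y * I) * (ρ * Complex.exp (Complex.I * φ)))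
      - ((x : ℂ) - y * I) ^ (2 * q))‖ =
    Real.exp (2 * π * ρ * (x * Real.sin φ - y * Real.cos φ)
      - (((x : ℂ) - y * I) ^ (2 * q)).re) := by
  rw [Complex.norm_exp, sub_re]
  congr 2
  have : Complex.exp (Complex.I * φ) = Real.cos φ + Real.sin φ * I := by
    rw [mul_comm, Complex.exp_mul_I]; simp
  rw [this]
  simp only [neg_re, mul_re, mul_im, add_re, add_im, sub_re, sub_im, I_re, I_im, ofReal_re, ofReal_im, re_ofNat, im_ofNat]
  ring

lemma lin_bound (θ φ d : ℝ) (hd0 : 0 < d) (hd : d ≤ π / 2) (hθ : θ < π / 2) (h : |φ| ≤ θ - d)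
    (x : ℝ) (a : ℝ) (ha : 0 ≤ a) (hx : |x| ≤ a) :
    x * Real.sin φ - Real.tan θ * a * Real.cos φ ≤ - (a * Real.sin d) := by
  have h0 : 0 ≤ |φ| := abs_nonneg φ
  have hc : 0 < Real.cos θ := Real.cos_pos_of_mem_Ioo ⟨by linarith, hθ⟩
  have hs : |Real.sin φ| = Real.sin |φ| := by
    rw [← Real.abs_sin_eq_sin_abs_of_abs_le_pi (by linarith)]
  have h1 : x * Real.sin φ ≤ a * Real.sin |φ| := by
    rw [← hs]
    exact (le_abs_self _).trans (by rw [abs_mul]; exact mul_le_mul_of_nonneg_right hx (abs_nonneg _))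
  have h2 : Real.sin d ≤ Real.sin (θ - |φ|) :=
    Real.sin_le_sin_of_le_of_le_pi_div_two (by linarith) (by linarith) (by linarith)
  have h3 : Real.sin (θ - |φ|) = (Real.tan θ * Real.cos φ - Real.sin |φ|) * Real.cos θ := by
    rw [Real.sin_sub, Real.cos_abs, sub_mul, mul_right_comm, Real.tan_mul_cos hc.ne']; ring
  have hsd : 0 < Real.sin d := Real.sin_pos_of_pos_of_lt_pi hd0 (by linarith)
  have h4 : Real.sin d ≤ Real.tan θ * Real.cos φ - Real.sin |φ| := by
    have h5 : 0 < Real.tan θ * Real.cos φ - Real.sin |φ| := by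
      by_contra hh
      nlinarith
    nlinarith [Real.cos_le_one θ]
  nlinarith

lemma v_tendsto (q : ℕ) (hq : 1 ≤ q) (c0 b : ℝ) (hc0 : 0 < c0) :
    Tendsto (fun X : ℝ => X * Real.exp (b * X - c0 * X ^ (2 * q))) atTop (𝓝 0) := by
  have h1 : Tendsto (fun X : ℝ => X ^ 1 * Real.exp (-X)) atTop (𝓝 0) :=
    Real.tendsto_pow_mul_exp_neg_atTop_nhds_zero 1
  refine tendsto_of_tendsto_of_tendsto_of_le_of_le' tendsto_const_nhds h1 ?_ ?_
  · filter_upwards [eventually_ge_atTop 0] with X hX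
    positivity
  · filter_upwards [eventually_ge_atTop 1, eventually_ge_atTop ((b + 1) / c0)] with X hX hX2
    rw [pow_one]
    have h2 : X ^ 2 ≤ X ^ (2 * q) := pow_le_pow_right₀ hX (by omega)
    rw [div_le_iff₀ hc0] at hX2
    refine mul_le_mul_of_nonneg_left (Real.exp_le_exp.2 ?_) (by linarith)
    nlinarith [mul_le_mul_of_nonneg_left h2 hc0.le,
      mul_le_mul_of_nonneg_right hX2 (by linarith : (0:ℝ) ≤ X)]

lemma sq_le_one_add_pow (q : ℕ) (hq : 1 ≤ q) (x : ℝ) : x ^ 2 ≤ 1 + x ^ (2 * q) := by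
  rw [pow_mul]
  rcases le_total (x ^ 2) 1 with h | h
  · have : 0 ≤ (x ^ 2) ^ q := by positivity
    linarith
  · have := le_self_pow₀ h (by omega : q ≠ 0)
    linarith


set_option maxHeartbeats 2000000 in
/-- Saddle-point estimate: in the sector `|arg ξ| < π/(4q) − δ`, the entire function
`F_q` satisfies `|F_q(ρe^{iφ})| ≤ C exp(−c ρ^{2q/(2q−1)})`. -/
theorem Fq_sector_decay (q : ℕ) (hq : 1 ≤ q) (δ : ℝ) (hδ : 0 < δ) :
    ∃ C > (0 : ℝ), ∃ c > (0 : ℝ), ∀ ρ : ℝ, 0 < ρ → ∀ φ : ℝ,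
      -π / (4 * q) + δ < φ → φ < π / (4 * q) - δ →
      ‖FqC q (ρ * Complex.exp (Complex.I * φ))‖
        ≤ C * Real.exp (-c * ρ ^ ((2 * q : ℝ) / (2 * q - 1))) := by
  by_cases hsm : δ < π / (4 * q)
  swap
  · refine ⟨1, one_pos, 1, one_pos, fun ρ _ φ h1 h2 => absurd ?_ hsm⟩
    rw [neg_div] at h1
    linarith
  have hq1 : (1 : ℝ) ≤ q := by exact_mod_cast hq
  have hpi := Real.pi_pos
  have hb4 : π / (4 * q) ≤ π / 4 := div_le_div_of_nonneg_left hpi.le (by norm_num) (by linarith)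
  obtain ⟨θ, hθ⟩ : ∃ θ, θ = π / (4 * q) - δ / 2 := ⟨_, rfl⟩
  have hθ0 : 0 < θ := by linarith
  have hθ2 : θ < π / 2 := by linarith
  have h2qθ : 2 * q * θ = π / 2 - q * δ := by
    rw [hθ]; field_simp; ring
  have hqδ : 0 < q * δ := by positivity
  have h2qθ0 : 0 < 2 * q * θ := by positivity
  obtain ⟨c0, hc0⟩ : ∃ c0, c0 = Real.cos (2 * q * θ) := ⟨_, rfl⟩
  have hc0p : 0 < c0 := by
    rw [hc0]; exact Real.cos_pos_of_mem_Ioo ⟨by linarith, by linarith⟩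
  obtain ⟨T, hTd⟩ : ∃ T, T = Real.tan θ := ⟨_, rfl⟩
  have hT : 0 ≤ T := by
    rw [hTd]; exact Real.tan_nonneg_of_nonneg_of_le_pi_div_two hθ0.le hθ2.le
  obtain ⟨κ, hκ⟩ : ∃ κ, κ = Real.sin (δ / 2) := ⟨_, rfl⟩
  have hκ0 : 0 < κ := by
    rw [hκ]; exact Real.sin_pos_of_pos_of_lt_pi (by linarith) (by linarith)
  have hκ1 : κ ≤ 1 := hκ ▸ Real.sin_le_one _
  obtain ⟨M, hM⟩ : ∃ M, M = (1 + T) ^ (2 * q) := ⟨_, rfl⟩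
  have hM1 : 1 ≤ M := by rw [hM]; exact one_le_pow₀ (by linarith)
  obtain ⟨ε, hε⟩ : ∃ ε, ε = κ / M := ⟨_, rfl⟩
  have hε0 : 0 < ε := by rw [hε]; positivity
  have hεM : M * ε = κ := by rw [hε]; field_simp
  have hε1 : ε ≤ 1 := by nlinarith
  obtain ⟨c, hc⟩ : ∃ c, c = π * κ * ε / 2 := ⟨_, rfl⟩
  have hcp : 0 < c := by rw [hc]; positivity
  obtain ⟨J, hJ⟩ : ∃ J, J = ∫ x : ℝ, Real.exp c0 * Real.exp (-c0 * x ^ 2) := ⟨_, rfl⟩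
  have hJ0 : 0 ≤ J := by rw [hJ]; exact integral_nonneg fun x => by positivity
  refine ⟨2 * (1 + 1 / c) + 2 * (1 + T) * J, by positivity, c, hcp, ?_⟩
  intro ρ hρ φ hφ1 hφ2
  have hφ : |φ| ≤ θ - δ / 2 := by
    rw [neg_div] at hφ1
    exact abs_le.2 ⟨by linarith, by linarith⟩
  have hcosφ : 0 ≤ Real.cos φ := by
    have := abs_le.1 hφ
    exact Real.cos_nonneg_of_mem_Icc ⟨by linarith, by linarith⟩
  obtain ⟨R, hR⟩ : ∃ R, R = ρ ^ ((2 * q : ℝ) / (2 * q - 1)) := ⟨_, rfl⟩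
  have hR0 : 0 < R := by rw [hR]; positivity
  rw [← hR]
  obtain ⟨u, hu⟩ : ∃ u, u = ρ ^ ((1 : ℝ) / (2 * q - 1)) := ⟨_, rfl⟩
  have hu0 : 0 < u := by rw [hu]; positivity
  have hne : (2 * q - 1 : ℝ) ≠ 0 := by linarith
  have hρu : ρ * u = R := by
    rw [hu, hR]
    nth_rewrite 1 [← Real.rpow_one ρ]
    rw [← Real.rpow_add hρ]
    congr 1
    field_simp
    ring
  have huR : u ^ (2 * q) = R := by
    rw [hu, hR, ← Real.rpow_natCast, ← Real.rpow_mul hρ.le]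
    congr 1
    push_cast
    ring
  obtain ⟨a, ha⟩ : ∃ a, a = ε * u := ⟨_, rfl⟩
  have ha0 : 0 < a := by rw [ha]; positivity
  have hρa : ρ * a = ε * R := by rw [ha, ← hρu]; ring
  have haR : a ^ (2 * q) ≤ ε ^ 2 * R := by
    rw [ha, mul_pow, huR]
    exact mul_le_mul_of_nonneg_right (pow_le_pow_of_le_one hε0.le hε1 (by omega)) hR0.le
  have hale : a ≤ 1 + R := by
    have h1 := sq_le_one_add_pow q hq u
    rw [huR] at h1
    have h2 : a ≤ u := by rw [ha]; nlinarith
    nlinarith [sq_nonneg (u - 1)]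
  have hgint : Integrable (fun x : ℝ => Real.exp (-(2 * c) * R) *
      (Real.exp c0 * Real.exp (-c0 * x ^ 2))) :=
    ((integrable_exp_neg_mul_sq hc0p).const_mul _).const_mul _
  have hrepow : ∀ x y : ℝ, x ≠ 0 → 0 ≤ y → y ≤ T * |x| →
      c0 * x ^ (2 * q) ≤ (((x : ℂ) - y * I) ^ (2 * q)).re := by
    intro x y hx hy0 hy
    have := re_pow_bound q θ hθ0.le (by linarith) hθ2 (hc0 ▸ hc0p.le) x (-y) hx
      (by rw [abs_neg, abs_of_nonneg hy0, ← hTd]; exact hy)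
    rw [← hc0] at this
    convert this using 3
    push_cast; ring
  have hlin := lin_bound θ φ (δ / 2) (by linarith) (by linarith) hθ2 hφ
  rw [← hTd, ← hκ] at hlin
  have main := contour_bound
    (fun z : ℂ => Complex.exp (-(2 * π * Complex.I * z * (ρ * Complex.exp (Complex.I * φ)))
      - z ^ (2 * q))) (by fun_prop) T a (Real.exp (-(2 * c) * R)) hT ha0
    (fun x : ℝ => Real.exp (-(2 * c) * R) * (Real.exp c0 * Real.exp (-c0 * x ^ 2)))
    hgint (fun x => by positivity) (fun x => by simp)
    (by
      intro x hx
      rw [norm_f]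
      apply Real.exp_le_exp.2
      have h1 := hlin x a ha0.le hx
      have h2 : -(((x : ℂ) - (T * a : ℝ) * I) ^ (2 * q)).re ≤ M * a ^ (2 * q) := by
        refine (neg_le_abs _).trans ((abs_re_le_norm _).trans ?_)
        rw [norm_pow, hM, ← mul_pow]
        refine pow_le_pow_left₀ (norm_nonneg _) ((norm_sub_le _ _).trans ?_) _
        have h3 : |T * a| = T * a := abs_of_nonneg (by positivity)
        rw [norm_mul, norm_I, mul_one, norm_real, norm_real, Real.norm_eq_abs, Real.norm_eq_abs,
          h3]
        linarith
      have h4 : M * a ^ (2 * q) ≤ κ * (ε * R) := by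
        calc M * a ^ (2 * q) ≤ M * (ε ^ 2 * R) := by gcongr
          _ = (M * ε) * (ε * R) := by ring
          _ = _ := by rw [hεM]
      have h5 : 2 * π * ρ * (x * Real.sin φ - T * a * Real.cos φ) ≤ - (2 * π * κ * (ε * R)) := by
        calc _ ≤ 2 * π * ρ * (-(a * κ)) := mul_le_mul_of_nonneg_left h1 (by positivity)
          _ = - (2 * π * κ * (ρ * a)) := by ring
          _ = _ := by rw [hρa]
      have h6 : κ * (ε * R) ≤ π * (κ * (ε * R)) := by
        have : (1:ℝ) ≤ π := by linarith [Real.pi_gt_three]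
        have h7 : 0 ≤ κ * (ε * R) := by positivity
        nlinarith
      have h8 : -(2 * c) * R = - (π * (κ * (ε * R))) := by rw [hc]; ring
      rw [h8]
      linarith)
    (by
      intro x hx
      rw [norm_f, ← Real.exp_add, ← Real.exp_add]
      apply Real.exp_le_exp.2
      have hx0 : x ≠ 0 := abs_pos.1 (ha0.trans_le hx)
      have h1 := hlin x |x| (abs_nonneg _) le_rfl
      have h2 := hrepow x (T * |x|) hx0 (by positivity) le_rfl
      have h3 := mul_le_mul_of_nonneg_left (sq_le_one_add_pow q hq x) hc0p.le
      have h5 : 2 * π * ρ * (x * Real.sin φ - T * |x| * Real.cos φ)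
          ≤ - (2 * π * κ * (ε * R)) := by
        calc _ ≤ 2 * π * ρ * (-(|x| * κ)) := mul_le_mul_of_nonneg_left h1 (by positivity)
          _ = - (2 * π * κ * (ρ * |x|)) := by ring
          _ ≤ - (2 * π * κ * (ρ * a)) := by gcongr
          _ = _ := by rw [hρa]
      have h8 : -(2 * c) * R = - (π * (κ * (ε * R))) := by rw [hc]; ring
      have h9 : 0 ≤ π * (κ * (ε * R)) := by positivity
      rw [h8]
      linarith)
    (fun X => Real.exp (2 * π * ρ * X - c0 * X ^ (2 * q)))
    (by
      intro x hx y hy0 hy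
      rw [norm_f]
      apply Real.exp_le_exp.2
      have hx0 : x ≠ 0 := abs_pos.1 (ha0.trans_le hx)
      have h2 := hrepow x y hx0 hy0 hy
      rw [(even_two_mul q).pow_abs]
      have h3 : x * Real.sin φ ≤ |x| := by
        refine (le_abs_self _).trans ?_
        rw [abs_mul]
        exact mul_le_of_le_one_right (abs_nonneg _) (Real.abs_sin_le_one _)
      have h4 : x * Real.sin φ - y * Real.cos φ ≤ |x| := by
        have : 0 ≤ y * Real.cos φ := by positivity
        linarith
      have h5 := mul_le_mul_of_nonneg_left h4 (by positivity : 0 ≤ 2 * π * ρ)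
      linarith)
    (v_tendsto q hq c0 _ hc0p)
  rw [integral_const_mul, ← hJ] at main
  refine main.trans ?_
  have e1 : Real.exp (-(2 * c) * R) = Real.exp (-c * R) * Real.exp (-c * R) := by
    rw [← Real.exp_add]; congr 1; ring
  have e2 : Real.exp (-c * R) ≤ 1 := Real.exp_le_one_iff.2 (by nlinarith)
  have e3 : (1 + R) * Real.exp (-c * R) ≤ 1 + 1 / c := by
    have h1 : c * R + 1 ≤ Real.exp (c * R) := Real.add_one_le_exp _
    have h2 : Real.exp (c * R) * Real.exp (-c * R) = 1 := by
      rw [← Real.exp_add]; simp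
    have h3 : R * Real.exp (-c * R) ≤ 1 / c := by
      rw [le_div_iff₀ hcp]
      have := mul_le_mul_of_nonneg_right h1 (Real.exp_pos (-c * R)).le
      nlinarith [Real.exp_pos (-c * R)]
    linarith
  have e0 := Real.exp_pos (-c * R)
  rw [e1]
  generalize Real.exp (-c * R) = E at *
  have f1 : a * E ≤ 1 + 1 / c := (mul_le_mul_of_nonneg_right hale e0.le).trans e3
  have f2 : J * E ≤ J := mul_le_of_le_one_right hJ0 e2
  calc _ = (2 * (a * E) + 2 * (1 + T) * (J * E)) * E := by ring
    _ ≤ _ := by gcongr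
end

section
/- Fix an integer q ≥ 1. There is a constant C = C(q) > 0 such that for all ε > 0, all integers j ≥ 0, and all complex z with |z| ≤ 1 and z ≠ 1, the function S_ε(z) = Σ_{n≥1} φ_q(nε) z^{n−1} satisfies |S_ε^{(j)}(z)| ≤ (C/|1−z|)^{j+1} · j!, where φ_q(t) = (1/A_q) ∫ exp(−s^{2q} − (t−s)^{2q}) ds with A_q chosen so that φ_q(0) = 1. -/
open Real MeasureTheory Complex Metric

/-- The normalisation constant `A_q = ∫ exp(−2 s^{2q}) ds`. -/
noncomputable def Aq (q : ℕ) : ℝ := ∫ s : ℝ, Real.exp (-(2 * s ^ (2 * q)))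

/-- `φ_q(t) = (1/A_q) ∫ exp(−s^{2q} − (t−s)^{2q}) ds`. -/
noncomputable def phiq (q : ℕ) (t : ℝ) : ℝ :=
  (1 / Aq q) * ∫ s : ℝ, Real.exp (-(s ^ (2 * q)) - (t - s) ^ (2 * q))

/-- `S_ε(z) = Σ_{n≥1} φ_q(nε) z^{n−1}`. -/
noncomputable def Seps (q : ℕ) (ε : ℝ) (z : ℂ) : ℂ :=
  ∑' n : ℕ, (phiq q ((n + 1) * ε) : ℂ) * z ^ n


lemma ps_summable_D (a : ℕ → ℂ) (ha : ∀ R : ℝ, Summable fun n => ‖a n‖ * R ^ n) (R : ℝ) :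
    Summable fun n : ℕ => ‖((n : ℂ) + 1) * a (n + 1)‖ * R ^ n := by
  have h := (summable_nat_add_iff 1).2 (ha (2 * (|R| + 1)))
  refine Summable.of_norm_bounded h (fun n => ?_)
  have h1 : ((n : ℝ) + 1) ≤ 2 ^ (n + 1) := by
    exact_mod_cast (Nat.lt_two_pow_self (n := n + 1)).le
  have h2 : ‖((n : ℂ) + 1)‖ = (n : ℝ) + 1 := by
    have : ((n : ℂ) + 1) = ((n + 1 : ℕ) : ℂ) := by push_cast; ring
    rw [this, Complex.norm_natCast]; push_cast; ring
  rw [norm_mul, norm_norm, norm_mul, h2, norm_pow, Real.norm_eq_abs, mul_pow]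
  have h3 : |R| ^ n ≤ (|R| + 1) ^ (n + 1) := by
    calc |R| ^ n ≤ (|R| + 1) ^ n := by gcongr; linarith
      _ ≤ (|R| + 1) ^ (n + 1) := pow_le_pow_right₀ (by linarith [abs_nonneg R]) (by omega)
  calc ((n : ℝ) + 1) * ‖a (n + 1)‖ * |R| ^ n
      ≤ 2 ^ (n + 1) * ‖a (n + 1)‖ * (|R| + 1) ^ (n + 1) := by gcongr
    _ = _ := by ring

lemma ps_hasDerivAt (a : ℕ → ℂ) (ha : ∀ R : ℝ, Summable fun n => ‖a n‖ * R ^ n) (z : ℂ) :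
    HasDerivAt (fun z => ∑' n : ℕ, a n * z ^ n) (∑' n : ℕ, (((n : ℂ) + 1) * a (n + 1)) * z ^ n) z := by
  set R : ℝ := ‖z‖ + 1
  have hR : 0 ≤ R := by positivity
  have hu : Summable fun n : ℕ => ‖(n : ℂ) * a n‖ * R ^ (n - 1) := by
    rw [← summable_nat_add_iff 1]
    simpa using ps_summable_D a ha R
  have key := hasDerivAt_tsum_of_isPreconnected (𝕜 := ℂ) (F := ℂ)
    (g := fun n z => a n * z ^ n) (g' := fun n z => a n * (n * z ^ (n - 1)))
    (t := ball (0 : ℂ) R) (y₀ := 0) (y := z) hu isOpen_ball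
    (convex_ball _ _).isPreconnected
    (fun n y _ => (hasDerivAt_pow n y).const_mul (a n))
    (fun n y hy => by
      have hy' : ‖y‖ ≤ R := (mem_ball_zero_iff.1 hy).le
      rw [norm_mul, norm_mul, norm_mul, norm_pow]
      calc ‖a n‖ * (‖(n : ℂ)‖ * ‖y‖ ^ (n - 1)) ≤ ‖a n‖ * (‖(n : ℂ)‖ * R ^ (n - 1)) := by gcongr
        _ = _ := by ring)
    (by simp; positivity)
    (by
      have := ha 0
      refine Summable.of_norm ?_
      simpa [norm_mul, norm_pow] using this)
    (by simp [R])
  refine key.congr_deriv ?_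
  have hs : Summable fun n : ℕ => a n * (n * z ^ (n - 1)) := by
    refine Summable.of_norm_bounded hu (fun n => ?_)
    rw [norm_mul, norm_mul, norm_mul, norm_pow]
    have : ‖z‖ ≤ R := by simp [R]
    calc ‖a n‖ * (‖(n : ℂ)‖ * ‖z‖ ^ (n - 1)) ≤ ‖a n‖ * (‖(n : ℂ)‖ * R ^ (n - 1)) := by gcongr
        _ = _ := by ring
  rw [hs.tsum_eq_zero_add]
  simp only [Nat.cast_zero, zero_mul, mul_zero, zero_add]
  refine tsum_congr fun n => ?_
  push_cast
  ring

lemma ps_summable_Dj (a : ℕ → ℂ) (ha : ∀ R : ℝ, Summable fun n => ‖a n‖ * R ^ n) (j : ℕ) :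
    ∀ R : ℝ, Summable fun n : ℕ => ‖((n + j).descFactorial j : ℂ) * a (n + j)‖ * R ^ n := by
  induction j with
  | zero => simpa using ha
  | succ j ih =>
    intro R
    refine (ps_summable_D _ ih R).congr fun n => ?_
    congr 2
    rw [← mul_assoc, Nat.descFactorial_succ]
    have : n + (j + 1) - j = n + 1 := by omega
    rw [this]
    have e : n + (j + 1) = n + 1 + j := by omega
    rw [e]; push_cast; ring

lemma ps_iteratedDeriv (a : ℕ → ℂ) (ha : ∀ R : ℝ, Summable fun n => ‖a n‖ * R ^ n) (j : ℕ) :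
    iteratedDeriv j (fun z : ℂ => ∑' n : ℕ, a n * z ^ n)
      = fun z => ∑' n : ℕ, (((n + j).descFactorial j : ℂ) * a (n + j)) * z ^ n := by
  induction j with
  | zero => simp
  | succ j ih =>
    rw [iteratedDeriv_succ, ih]
    funext z
    rw [(ps_hasDerivAt _ (ps_summable_Dj a ha j) z).deriv]
    refine tsum_congr fun n => ?_
    rw [← mul_assoc ((n : ℂ) + 1), Nat.descFactorial_succ]
    have : n + (j + 1) - j = n + 1 := by omega
    rw [this]
    have e : n + (j + 1) = n + 1 + j := by omega
    rw [e]; push_cast; ring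

lemma kernel_bound (K : ℝ) (hK : 1 ≤ K) (μ z : ℂ) (hμ : ‖μ‖ ≤ K * μ.re) (hz : ‖z‖ < 1) :
    ‖Complex.exp (-μ) / (1 - z * Complex.exp (-μ))‖ ≤ (1 + 2 * K) / ‖1 - z‖ := by
  have hre : 0 ≤ μ.re := by
    have := norm_nonneg μ
    nlinarith
  have hz1 : 0 < ‖1 - z‖ := by
    rw [norm_pos_iff, sub_ne_zero]; rintro rfl; simp at hz
  have e1 : Complex.exp (-μ) / (1 - z * Complex.exp (-μ)) = 1 / (Complex.exp μ - z) := by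
    rw [Complex.exp_neg]
    have := Complex.exp_ne_zero μ
    rw [show (1 - z * (Complex.exp μ)⁻¹) = (Complex.exp μ - z) * (Complex.exp μ)⁻¹ by
      field_simp]
    rw [div_mul_eq_div_div_swap, div_self (inv_ne_zero this)]
  have h1 : μ.re ≤ ‖Complex.exp μ - z‖ := by
    have := norm_sub_norm_le (Complex.exp μ) z
    rw [Complex.norm_exp] at this
    have := Real.add_one_le_exp μ.re
    linarith
  have h0 : 0 < ‖Complex.exp μ - z‖ := by
    have := norm_sub_norm_le (Complex.exp μ) z
    rw [Complex.norm_exp] at this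
    have := Real.add_one_le_exp μ.re
    linarith
  rw [e1, norm_div, norm_one, div_le_div_iff₀ h0 hz1, one_mul]
  rcases le_or_gt ‖μ‖ 1 with h | h
  · have h2 := Complex.norm_exp_sub_one_le h
    have h3 : ‖1 - z‖ ≤ ‖Complex.exp μ - z‖ + ‖Complex.exp μ - 1‖ := by
      have : 1 - z = (Complex.exp μ - z) - (Complex.exp μ - 1) := by ring
      rw [this]; exact norm_sub_le _ _
    nlinarith
  · have h3 : ‖1 - z‖ ≤ 2 := by
      have := norm_sub_le 1 z
      rw [norm_one] at this; linarith
    nlinarith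

lemma abstract_bound {X : Type*} [MeasurableSpace X] (ν : Measure X) (G Λ : X → ℂ)
    (hG : Integrable G ν) (hΛm : AEStronglyMeasurable Λ ν) (K : ℝ) (hK : 1 ≤ K)
    (hΛ : ∀ᵐ x ∂ν, ‖Λ x‖ ≤ K * (Λ x).re) (ε : ℝ) (hε : 0 < ε) (j : ℕ) (z : ℂ) (hz : ‖z‖ < 1) :
    (Summable fun n : ℕ => (((n + j).descFactorial j : ℂ) *
        ∫ x, G x * Complex.exp (-(Λ x * (((n + j : ℕ) + 1 : ℝ) * ε : ℝ))) ∂ν) * z ^ n) ∧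
    ‖∑' n : ℕ, (((n + j).descFactorial j : ℂ) *
        ∫ x, G x * Complex.exp (-(Λ x * (((n + j : ℕ) + 1 : ℝ) * ε : ℝ))) ∂ν) * z ^ n‖
      ≤ (∫ x, ‖G x‖ ∂ν) * (((1 + 2 * K) / ‖1 - z‖) ^ (j + 1) * j.factorial) := by
  set F : ℕ → X → ℂ := fun n x => (((n + j).descFactorial j : ℂ) *
        (G x * Complex.exp (-(Λ x * (((n + j : ℕ) + 1 : ℝ) * ε : ℝ))))) * z ^ n with hF
  have hexp : ∀ n : ℕ, ∀ᵐ x ∂ν, ‖Complex.exp (-(Λ x * (((n + j : ℕ) + 1 : ℝ) * ε : ℝ)))‖ ≤ 1 := by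
    intro n
    filter_upwards [hΛ] with x hx
    have hre : 0 ≤ (Λ x).re := by
      have := norm_nonneg (Λ x)
      nlinarith
    rw [Complex.norm_exp, Complex.neg_re, Complex.re_mul_ofReal]
    apply Real.exp_le_one_iff.2
    have : 0 ≤ (Λ x).re * (((n + j : ℕ) + 1 : ℝ) * ε) := by positivity
    linarith
  have hI0 : ∀ n : ℕ, Integrable (fun x => G x * Complex.exp (-(Λ x * (((n + j : ℕ) + 1 : ℝ) * ε : ℝ)))) ν := by
    intro n
    refine hG.mul_bdd (c := 1) ?_ (hexp n)
    exact Complex.continuous_exp.comp_aestronglyMeasurable ((hΛm.mul_const _).neg)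
  have hFI : ∀ n, Integrable (F n) ν := fun n => ((hI0 n).const_mul _).mul_const _
  have hchoose : ∀ n : ℕ, ((n + j).descFactorial j : ℝ) = (j.factorial : ℝ) * ((n + j).choose j : ℝ) := by
    intro n; rw [Nat.descFactorial_eq_factorial_mul_choose]; push_cast; ring
  have hchooseC : ∀ n : ℕ, ((n + j).descFactorial j : ℂ) = (j.factorial : ℂ) * ((n + j).choose j : ℂ) := by
    intro n; rw [Nat.descFactorial_eq_factorial_mul_choose]; push_cast; ring
  have hsum : Summable fun n => ∫ x, ‖F n x‖ ∂ν := by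
    have hs := ((hasSum_choose_mul_geometric_of_norm_lt_one (𝕜 := ℝ) j (r := ‖z‖) (by simpa using hz)).summable).mul_left ((∫ x, ‖G x‖ ∂ν) * j.factorial)
    refine Summable.of_nonneg_of_le (fun n => by positivity) (fun n => ?_) hs
    have : ∫ x, ‖F n x‖ ∂ν ≤ ∫ x, ‖G x‖ * (((n + j).descFactorial j : ℝ) * ‖z‖ ^ n) ∂ν := by
      refine integral_mono_ae (hFI n).norm (hG.norm.mul_const _) ?_
      filter_upwards [hexp n] with x hx
      simp only [hF, norm_mul, norm_pow, Complex.norm_natCast]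
      calc _ ≤ ((n + j).descFactorial j : ℝ) * (‖G x‖ * 1) * ‖z‖ ^ n := by gcongr
        _ = _ := by ring
    refine this.trans (le_of_eq ?_)
    rw [integral_mul_const, hchoose]; ring
  have hS := hasSum_integral_of_summable_integral_norm hFI hsum
  have e1 : ∀ n, ∫ x, F n x ∂ν = (((n + j).descFactorial j : ℂ) *
        ∫ x, G x * Complex.exp (-(Λ x * (((n + j : ℕ) + 1 : ℝ) * ε : ℝ))) ∂ν) * z ^ n := by
    intro n
    simp only [hF]
    rw [integral_mul_const, integral_const_mul]
  simp_rw [← e1]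
  refine ⟨hS.summable, ?_⟩
  rw [hS.tsum_eq]
  rw [← integral_mul_const]
  refine norm_integral_le_of_norm_le (hG.norm.mul_const _) ?_
  filter_upwards [hΛ] with x hx
  have hre : 0 ≤ (Λ x).re := by
    have := norm_nonneg (Λ x)
    nlinarith
  set μ : ℂ := Λ x * ε with hμ
  have hμn : ‖μ‖ ≤ K * μ.re := by
    rw [hμ, Complex.re_mul_ofReal, norm_mul, Complex.norm_real, Real.norm_of_nonneg hε.le]
    nlinarith
  have hμre : 0 ≤ μ.re := by rw [hμ, Complex.re_mul_ofReal]; positivity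
  have hr : ‖z * Complex.exp (-μ)‖ < 1 := by
    rw [norm_mul, Complex.norm_exp]
    have : Real.exp (-μ).re ≤ 1 := Real.exp_le_one_iff.2 (by simpa using hμre)
    nlinarith [norm_nonneg z, Real.exp_pos (-μ).re]
  have hgs := (hasSum_choose_mul_geometric_of_norm_lt_one j hr).mul_left
    (G x * j.factorial * Complex.exp (-μ) ^ (j + 1))
  have e2 : ∀ n, F n x = G x * j.factorial * Complex.exp (-μ) ^ (j + 1) * (((n + j).choose j : ℂ) * (z * Complex.exp (-μ)) ^ n) := by
    intro n
    simp only [hF]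
    have : Complex.exp (-(Λ x * (((n + j : ℕ) + 1 : ℝ) * ε : ℝ))) = Complex.exp (-μ) ^ (j + 1) * Complex.exp (-μ) ^ n := by
      rw [← pow_add, ← Complex.exp_nat_mul]
      congr 1; rw [hμ]; push_cast; ring
    rw [this, hchooseC, mul_pow]; ring
  simp_rw [e2]
  rw [hgs.tsum_eq]
  have e3 : G x * j.factorial * Complex.exp (-μ) ^ (j + 1) * (1 / (1 - z * Complex.exp (-μ)) ^ (j + 1))
      = G x * ((Complex.exp (-μ) / (1 - z * Complex.exp (-μ))) ^ (j + 1) * j.factorial) := by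
    rw [div_pow]; ring
  rw [e3, norm_mul, norm_mul, norm_pow, Complex.norm_natCast]
  gcongr
  exact kernel_bound K hK μ z hμn hz

lemma norm_pow_sub_pow_bound (a b : ℂ) (r : ℝ) (ha : ‖a‖ ≤ r) (hb : ‖b‖ ≤ r) (n : ℕ) :
    ‖a ^ n - b ^ n‖ ≤ n * ‖a - b‖ * r ^ (n - 1) := by
  have hr : 0 ≤ r := (norm_nonneg a).trans ha
  rw [← (Commute.all a b).geom_sum₂_mul n, norm_mul]
  have : ‖∑ i ∈ Finset.range n, a ^ i * b ^ (n - 1 - i)‖ ≤ ∑ i ∈ Finset.range n, r ^ (n - 1) := by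
    refine norm_sum_le_of_le _ fun i hi => ?_
    rw [norm_mul, norm_pow, norm_pow]
    have : i + (n - 1 - i) = n - 1 := by
      have := Finset.mem_range.1 hi; omega
    calc ‖a‖ ^ i * ‖b‖ ^ (n - 1 - i) ≤ r ^ i * r ^ (n - 1 - i) := by gcongr
      _ = r ^ (n - 1) := by rw [← pow_add, this]
  rw [Finset.sum_const, Finset.card_range, nsmul_eq_mul] at this
  nlinarith [norm_nonneg (a - b)]

lemma re_pow_lower (q : ℕ) (hq : 1 ≤ q) : ∃ C : ℝ, 1 ≤ C ∧ ∀ u y : ℝ,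
    u ^ (2 * q) / 2 - C * |y| ^ (2 * q) ≤ ((((u : ℂ) + y * I)) ^ (2 * q)).re := by
  set p := 2 * q with hp
  have hp1 : 1 ≤ p := by omega
  have hpe : Even p := by rw [hp]; exact even_two_mul q
  set L : ℝ := p * 2 ^ p with hL
  have hL1 : 1 ≤ L := by
    have h1 : (1 : ℝ) ≤ p := by exact_mod_cast hp1
    have h2 : (1 : ℝ) ≤ 2 ^ p := one_le_pow₀ (by norm_num)
    nlinarith
  refine ⟨2 * (L + 1) ^ p, ?_, fun u y => ?_⟩
  · have : 1 ≤ (L + 1) ^ p := one_le_pow₀ (by linarith)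
    linarith
  have hu : u ^ p = |u| ^ p := (hpe.pow_abs u).symm
  have hnorm : ‖(u : ℂ) + y * I‖ ≤ |u| + |y| := by
    refine (norm_add_le _ _).trans ?_
    simp
  rcases le_or_gt (L * |y|) |u| with h | h
  · have h1 := norm_pow_sub_pow_bound ((u : ℂ) + y * I) u (2 * |u|)
      (hnorm.trans (by nlinarith [abs_nonneg y])) (by
        rw [Complex.norm_real, Real.norm_eq_abs]; linarith [abs_nonneg u]) p
    have h2 : ‖(u : ℂ) + y * I - u‖ = |y| := by simp
    rw [h2] at h1
    have h3 : (p : ℝ) * |y| * (2 * |u|) ^ (p - 1) ≤ |u| ^ p / 2 := by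
      obtain ⟨k, hk⟩ : ∃ k, p = k + 1 := ⟨p - 1, by omega⟩
      have : (p : ℝ) * |y| * (2 * |u|) ^ (p - 1) = (L * |y|) * |u| ^ (p - 1) / 2 := by
        rw [hL, hk]; simp only [Nat.add_sub_cancel]; rw [mul_pow, pow_succ]; ring
      rw [this]
      have : |u| ^ p = |u| * |u| ^ (p - 1) := by
        rw [hk]; simp only [Nat.add_sub_cancel]; rw [pow_succ]; ring
      rw [this]
      gcongr
    have h4 : -‖((u : ℂ) + y * I) ^ p - (u : ℂ) ^ p‖ ≤ (((u : ℂ) + y * I) ^ p - (u : ℂ) ^ p).re :=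
      (abs_le.1 (Complex.abs_re_le_norm _)).1
    have h5 : ((u : ℂ) ^ p).re = u ^ p := by rw [← Complex.ofReal_pow, Complex.ofReal_re]
    rw [Complex.sub_re, h5] at h4
    have : 0 ≤ 2 * (L + 1) ^ p * |y| ^ p := by positivity
    rw [hu] at *
    linarith
  · have h1 : -‖((u : ℂ) + y * I) ^ p‖ ≤ (((u : ℂ) + y * I) ^ p).re :=
      (abs_le.1 (Complex.abs_re_le_norm _)).1
    have h2 : ‖((u : ℂ) + y * I) ^ p‖ ≤ ((L + 1) * |y|) ^ p := by
      rw [norm_pow]; gcongr; linarith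
    have h3 : |u| ^ p ≤ ((L + 1) * |y|) ^ p := by
      gcongr; nlinarith [abs_nonneg y]
    rw [mul_pow] at h2 h3
    have : 0 ≤ (L + 1) ^ p * |y| ^ p := by positivity
    rw [hu]
    linarith

lemma pow_ge_sq (q : ℕ) (hq : 1 ≤ q) (s : ℝ) : s ^ 2 - 1 ≤ s ^ (2 * q) := by
  rw [pow_mul]
  rcases le_or_gt (s ^ 2) 1 with h | h
  · have : 0 ≤ (s ^ 2) ^ q := by positivity
    linarith
  · have := le_self_pow₀ h.le (show q ≠ 0 by omega)
    linarith

/-- The integrand as an entire function of `ζ`, shifted by one. -/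
noncomputable def psi (q : ℕ) (s : ℝ) (ζ : ℂ) : ℂ :=
  Complex.exp (-((s : ℂ) ^ (2 * q)) - (ζ - 1 - s) ^ (2 * q))

lemma psi_bound (q : ℕ) (hq : 1 ≤ q) : ∃ θ : ℝ, 0 < θ ∧ θ ≤ 1 ∧ ∃ M : ℝ, 0 < M ∧
    ∀ s x v : ℝ, 0 ≤ v → v ≤ θ →
      ‖psi q s (Complex.exp (x + v * I))‖ ≤ M * Real.exp (-(1/2) * s ^ 2) / (1 + Real.exp (2 * x)) := by
  obtain ⟨C, hC, hre⟩ := re_pow_lower q hq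
  set p := 2 * q with hp
  have hp1 : 1 ≤ p := by omega
  have hpe : Even p := by rw [hp]; exact even_two_mul q
  set c : ℝ := 1 / (4 * 3 ^ p) with hc
  have hc0 : 0 < c := by positivity
  have h3p : (1 : ℝ) ≤ 3 ^ p := one_le_pow₀ (by norm_num)
  have hc1 : c ≤ 1 := by
    rw [hc, div_le_one (by positivity)]; linarith
  have h2p : (1 : ℝ) ≤ 2 ^ p := one_le_pow₀ (by norm_num)
  set θ : ℝ := c / (2 ^ p * C) with hθ
  have hθ0 : 0 < θ := by positivity
  have hθ1 : θ ≤ 1 := by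
    rw [hθ, div_le_one (by positivity)]; nlinarith
  refine ⟨θ, hθ0, hθ1, Real.exp 2 * (4 / c), by positivity, fun s x v hv0 hv => ?_⟩
  have hcos : 1 / 2 ≤ Real.cos v := by
    have := Real.one_sub_sq_div_two_le_cos (x := v)
    nlinarith
  have hsin : Real.sin v ≤ θ := (Real.sin_le hv0).trans hv
  have hsin0 : 0 ≤ Real.sin v := Real.sin_nonneg_of_nonneg_of_le_pi hv0 (by linarith [Real.pi_gt_three])
  set E := Real.exp x with hE
  have hE0 : 0 < E := Real.exp_pos x
  set X := E * Real.cos v with hX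
  set y := E * Real.sin v with hy
  set u := X - 1 - s with hu
  have hXE : E / 2 ≤ X := by rw [hX]; nlinarith
  have hX0 : 0 ≤ X := by linarith
  have hy0 : 0 ≤ y := by positivity
  have hyX : y ≤ 2 * θ * X := by
    have : y ≤ E * θ := by rw [hy]; gcongr
    nlinarith
  have e1 : Complex.exp (x + v * I) - 1 - s = (u : ℂ) + y * I := by
    rw [Complex.exp_add, Complex.exp_mul_I, hu, hX, hy, hE]
    push_cast; ring
  have hn : ‖psi q s (Complex.exp (x + v * I))‖ ≤ Real.exp (-s ^ p - (u ^ p / 2 - C * |y| ^ p)) := by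
    rw [psi, Complex.norm_exp, e1]
    apply Real.exp_le_exp.2
    have := hre u y
    rw [Complex.sub_re, Complex.neg_re, ← Complex.ofReal_pow, Complex.ofReal_re]
    linarith
  refine hn.trans ?_
  have h1 : X ^ p ≤ 3 ^ p * (s ^ p + 1 + u ^ p) := by
    have hs0 : 0 ≤ s ^ p := hpe.pow_nonneg s
    have hu0 : 0 ≤ u ^ p := hpe.pow_nonneg u
    have hm : ∃ m : ℝ, X ≤ 3 * m ∧ 0 ≤ m ∧ m ^ p ≤ s ^ p + 1 + u ^ p := by
      by_cases ha : X ≤ 3 * |s|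
      · exact ⟨|s|, ha, abs_nonneg _, by rw [hpe.pow_abs]; linarith⟩
      by_cases hb : X ≤ 3 * |u|
      · exact ⟨|u|, hb, abs_nonneg _, by rw [hpe.pow_abs]; linarith⟩
      refine ⟨1, ?_, zero_le_one, by rw [one_pow]; linarith⟩
      have := le_abs_self s
      have := le_abs_self u
      push Not at ha hb
      by_contra hcon
      push Not at hcon
      have : X = s + 1 + u := by rw [hu]; ring
      linarith
    obtain ⟨m, hm1, hm0, hm2⟩ := hm
    calc X ^ p ≤ (3 * m) ^ p := by gcongr
      _ = 3 ^ p * m ^ p := mul_pow _ _ _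
      _ ≤ _ := by gcongr
  have h2 : C * |y| ^ p ≤ c * X ^ p := by
    rw [abs_of_nonneg hy0]
    calc C * y ^ p ≤ C * (2 * θ * X) ^ p := by gcongr
      _ = C * 2 ^ p * θ ^ p * X ^ p := by rw [mul_pow, mul_pow]; ring
      _ ≤ C * 2 ^ p * θ * X ^ p := by
        gcongr
        exact pow_le_of_le_one hθ0.le hθ1 (by omega)
      _ = c * X ^ p := by rw [hθ]; field_simp
  have h3 : 2 * c * X ^ p ≤ (s ^ p + 1 + u ^ p) / 2 := by
    have : c * (3 ^ p * (s ^ p + 1 + u ^ p)) = (s ^ p + 1 + u ^ p) / 4 := by rw [hc]; field_simp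
    have : c * X ^ p ≤ c * (3 ^ p * (s ^ p + 1 + u ^ p)) := by gcongr
    linarith
  have hs2 := pow_ge_sq q hq s
  have hX2 := pow_ge_sq q hq X
  rw [← hp] at hs2 hX2
  have h4 : -s ^ p - (u ^ p / 2 - C * |y| ^ p) ≤ 2 + (-(1/2) * s ^ 2) + (-(c * X ^ 2)) := by
    have : c * (X ^ 2 - 1) ≤ c * X ^ p := by gcongr
    nlinarith
  calc Real.exp (-s ^ p - (u ^ p / 2 - C * |y| ^ p))
      ≤ Real.exp (2 + (-(1/2) * s ^ 2) + (-(c * X ^ 2))) := Real.exp_le_exp.2 h4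
    _ = Real.exp 2 * Real.exp (-(1/2) * s ^ 2) * Real.exp (-(c * X ^ 2)) := by
        rw [Real.exp_add, Real.exp_add]
    _ ≤ Real.exp 2 * Real.exp (-(1/2) * s ^ 2) * ((4 / c) / (1 + Real.exp (2 * x))) := by
        gcongr
        rw [Real.exp_neg, ← one_div, div_le_div_iff₀ (Real.exp_pos _) (by positivity), one_mul]
        have h5 := Real.add_one_le_exp (c * X ^ 2)
        have h6 : Real.exp (2 * x) = E ^ 2 := by rw [hE, ← Real.exp_nat_mul]; norm_num
        rw [h6]
        have h7 : E ^ 2 ≤ 4 * X ^ 2 := by nlinarith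
        calc 1 + E ^ 2 ≤ 4 / c * (c * X ^ 2 + 1) := by
              rw [mul_add, ← mul_assoc, div_mul_cancel₀ _ hc0.ne', mul_one]
              have : 1 ≤ 4 / c := by rw [le_div_iff₀ hc0]; linarith
              linarith
          _ ≤ _ := by gcongr
    _ = _ := by ring

lemma integrable_E : Integrable (fun x : ℝ => Real.exp x / (1 + Real.exp (2 * x))) := by
  have h1 : IntegrableOn (fun x : ℝ => Real.exp x / (1 + Real.exp (2 * x))) (Set.Iic 0) := by
    refine Integrable.mono' (integrableOn_exp_Iic 0) ?_ ?_
    · exact (Continuous.div (by fun_prop) (by fun_prop) (fun x => by positivity)).aestronglyMeasurable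
    · refine Filter.Eventually.of_forall fun x => ?_
      rw [Real.norm_of_nonneg (by positivity)]
      apply div_le_self (by positivity)
      have := Real.exp_pos (2 * x); linarith
  have h2 : IntegrableOn (fun x : ℝ => Real.exp x / (1 + Real.exp (2 * x))) (Set.Ioi 0) := by
    refine Integrable.mono' (integrableOn_exp_neg_Ioi 0) ?_ ?_
    · exact (Continuous.div (by fun_prop) (by fun_prop) (fun x => by positivity)).aestronglyMeasurable
    · refine Filter.Eventually.of_forall fun x => ?_
      rw [Real.norm_of_nonneg (by positivity), div_le_iff₀ (by positivity), mul_add, ← Real.exp_add]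
      have : -x + 2 * x = x := by ring
      rw [this]
      have := Real.exp_pos (-x); linarith
  rw [← integrableOn_univ, ← Set.Iic_union_Ioi (a := (0 : ℝ))]
  exact h1.union h2

open Filter Topology in
lemma strip_im_zero (H : ℂ → ℂ) (θ N R0 : ℝ) (hθ : 0 ≤ θ)
    (hd : ∀ w : ℂ, 0 ≤ w.im → w.im ≤ θ → DifferentiableAt ℂ H w)
    (hb : ∀ x v : ℝ, R0 ≤ |x| → 0 ≤ v → v ≤ θ → ‖H (x + v * I)‖ ≤ N * Real.exp (-|x|))
    (hreal : ∀ᵐ x : ℝ, (H x).im = 0)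
    (hinteg : Integrable fun x : ℝ => H (x + θ * I)) :
    (∫ x : ℝ, H (x + θ * I)).im = 0 := by
  have h1 := intervalIntegral_tendsto_integral hinteg tendsto_neg_atTop_atBot tendsto_id
  have h2 : Tendsto (fun R : ℝ => (∫ x in (-R)..R, H (x + θ * I)).im) atTop
      (𝓝 (∫ x : ℝ, H (x + θ * I)).im) := (Complex.continuous_im.tendsto _).comp h1
  have hV : ∀ r : ℝ, R0 ≤ |r| → ‖∫ y in (0 : ℝ)..θ, H (r + y * I)‖ ≤ N * Real.exp (-|r|) * θ := by
    intro r hr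
    have := intervalIntegral.norm_integral_le_of_norm_le_const (a := (0 : ℝ)) (b := θ)
      (f := fun y : ℝ => H (r + y * I)) (C := N * Real.exp (-|r|)) (fun y hy => by
        rw [Set.uIoc_of_le hθ] at hy
        exact hb r y hr hy.1.le hy.2)
    rwa [sub_zero, abs_of_nonneg hθ] at this
  have h3 : Tendsto (fun R : ℝ => (∫ x in (-R)..R, H (x + θ * I)).im) atTop (𝓝 0) := by
    have h4 : Tendsto (fun R : ℝ => 2 * (N * Real.exp (-R) * θ)) atTop (𝓝 0) := by
      have : Tendsto (fun R : ℝ => Real.exp (-R)) atTop (𝓝 0) :=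
        Real.tendsto_exp_atBot.comp tendsto_neg_atTop_atBot
      have := ((this.const_mul N).mul_const θ).const_mul 2
      simpa using this
    refine squeeze_zero_norm' ?_ h4
    filter_upwards [eventually_ge_atTop R0, eventually_ge_atTop 0] with R hR hR0
    have hc := Complex.integral_boundary_rect_eq_zero_of_differentiableOn H
      ((-R : ℝ) : ℂ) ((R : ℂ) + θ * I) (by
        intro w hw
        have hw' := hw.2
        simp only [Set.mem_preimage] at hw'
        simp [Set.uIcc_of_le hθ] at hw'
        exact (hd w hw'.1 hw'.2).differentiableWithinAt)
    simp only [Complex.ofReal_re, Complex.ofReal_im, Complex.add_re, Complex.mul_re, Complex.I_re,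
      Complex.I_im, Complex.add_im, Complex.mul_im, mul_zero, mul_one, sub_zero, add_zero, zero_add,
      Complex.ofReal_zero, zero_mul] at hc
    have hR1 : (∫ x in (-R)..R, H (x : ℂ)).im = 0 := by
      have : ∫ x in (-R)..R, H (x : ℂ) = ∫ x in (-R)..R, (((H x).re : ℝ) : ℂ) := by
        apply intervalIntegral.integral_congr_ae
        filter_upwards [hreal] with x hx _
        apply Complex.ext <;> simp [hx]
      rw [this, intervalIntegral.integral_ofReal, Complex.ofReal_im]
    have e : ∫ x in (-R)..R, H (x + θ * I) = (∫ x in (-R)..R, H (x : ℂ)) +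
        (I • (∫ y in (0 : ℝ)..θ, H (R + y * I)) - I • ∫ y in (0 : ℝ)..θ, H (((-R : ℝ) : ℂ) + y * I)) := by
      linear_combination -hc
    rw [e, Complex.add_im, hR1, zero_add]
    refine (Complex.abs_im_le_norm _).trans ((norm_sub_le _ _).trans ?_)
    rw [norm_smul, norm_smul, Complex.norm_I, one_mul, one_mul]
    have a1 := hV R (by rwa [abs_of_nonneg hR0])
    have a2 := hV (-R) (by rwa [abs_neg, abs_of_nonneg hR0])
    rw [abs_neg] at a2
    rw [abs_of_nonneg hR0] at a1 a2
    linarith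
  exact tendsto_nhds_unique h2 h3

/-- The reference kernel on the ray of angle `θ`. -/
noncomputable def kerK (θ x : ℝ) : ℂ :=
  2 * Complex.exp (x + θ * I) / (Complex.exp (x + θ * I) ^ 2 - 1)

noncomputable def kap (θ : ℝ) : ℝ := -(∫ x : ℝ, kerK θ x).im

lemma ray_sub_lower (θ r T : ℝ) : |T * Real.sin θ| ≤ ‖(r : ℂ) * Complex.exp (θ * I) - T‖ := by
  have h1 : ‖(r : ℂ) * Complex.exp (θ * I) - T‖ = ‖(r : ℂ) - T * Complex.exp ((-θ : ℝ) * I)‖ := by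
    have : (r : ℂ) * Complex.exp (θ * I) - T
        = ((r : ℂ) - T * Complex.exp ((-θ : ℝ) * I)) * Complex.exp (θ * I) := by
      rw [sub_mul, mul_assoc (T : ℂ), ← Complex.exp_add]; simp
    rw [this, norm_mul, Complex.norm_exp_ofReal_mul_I, mul_one]
  rw [h1]
  refine le_trans (le_of_eq ?_) (Complex.abs_im_le_norm _)
  rw [Complex.sub_im, Complex.ofReal_im, Complex.im_ofReal_mul, Complex.exp_ofReal_mul_I_im,
    Real.sin_neg]
  simp

lemma exp_xv (x v : ℝ) : Complex.exp (x + v * I) = ((Real.exp x : ℝ) : ℂ) * Complex.exp (v * I) := by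
  rw [Complex.exp_add, Complex.ofReal_exp]

lemma norm_exp_xv (x v : ℝ) : ‖Complex.exp (x + v * I)‖ = Real.exp x := by
  rw [Complex.norm_exp]; simp

lemma kerK_den (θ : ℝ) (x : ℝ) :
    |Real.sin (2 * θ)| * (1 + Real.exp (2 * x)) ≤ 2 * ‖Complex.exp (x + θ * I) ^ 2 - 1‖ := by
  have e : Complex.exp (x + θ * I) ^ 2 = ((Real.exp (2 * x) : ℝ) : ℂ) * Complex.exp ((2 * θ : ℝ) * I) := by
    rw [← exp_xv, ← Complex.exp_nat_mul]; congr 1; push_cast; ring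
  have h1 := ray_sub_lower (2 * θ) (Real.exp (2 * x)) 1
  rw [← e, one_mul, Complex.ofReal_one] at h1
  have h2 := Complex.abs_im_le_norm (Complex.exp (x + θ * I) ^ 2 - 1)
  rw [e, Complex.sub_im, Complex.im_ofReal_mul, Complex.exp_ofReal_mul_I_im, Complex.one_im, sub_zero,
    abs_mul, abs_of_pos (Real.exp_pos _), ← e] at h2
  linarith

lemma integrable_kerK (θ : ℝ) (hθ0 : 0 < θ) (hθ1 : θ ≤ 1) : Integrable (kerK θ) := by
  have hs : 0 < Real.sin (2 * θ) := Real.sin_pos_of_pos_of_lt_pi (by linarith) (by linarith [Real.pi_gt_three])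
  refine Integrable.mono' (integrable_E.const_mul (4 / Real.sin (2 * θ))) ?_ ?_
  · apply Measurable.aestronglyMeasurable
    unfold kerK
    fun_prop
  · refine Filter.Eventually.of_forall fun x => ?_
    have h := kerK_den θ x
    rw [abs_of_pos hs] at h
    have hpos : 0 < ‖Complex.exp (x + θ * I) ^ 2 - 1‖ := by
      have : 0 < Real.sin (2 * θ) * (1 + Real.exp (2 * x)) := by positivity
      linarith
    rw [kerK, norm_div, norm_mul, norm_exp_xv, Complex.norm_ofNat, div_mul_div_comm,
      div_le_div_iff₀ hpos (by positivity)]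
    have := Real.exp_pos x
    nlinarith

lemma kerK_im_neg (θ : ℝ) (hθ0 : 0 < θ) (hθ1 : θ ≤ 1) (x : ℝ) : (kerK θ x).im < 0 := by
  have hs : 0 < Real.sin θ := Real.sin_pos_of_pos_of_lt_pi (by linarith) (by linarith [Real.pi_gt_three])
  set ζ := Complex.exp (x + θ * I) with hζ
  have hζ0 : ζ ≠ 0 := Complex.exp_ne_zero _
  have e1 : kerK θ x = ((2 : ℝ) : ℂ) * (ζ - ζ⁻¹)⁻¹ := by
    rw [kerK, ← hζ]
    have : ζ ^ 2 - 1 = (ζ - ζ⁻¹) * ζ := by field_simp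
    rw [this, mul_div_mul_right _ _ hζ0, div_eq_mul_inv]; push_cast; rfl
  have e2 : (ζ - ζ⁻¹).im = (Real.exp x + Real.exp (-x)) * Real.sin θ := by
    have : ζ⁻¹ = ((Real.exp (-x) : ℝ) : ℂ) * Complex.exp ((-θ : ℝ) * I) := by
      rw [← exp_xv, hζ, ← Complex.exp_neg]; congr 1; push_cast; ring
    rw [this, hζ, exp_xv, Complex.sub_im, Complex.im_ofReal_mul, Complex.exp_ofReal_mul_I_im,
      Complex.im_ofReal_mul, Complex.exp_ofReal_mul_I_im, Real.sin_neg]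
    ring
  have hpos : 0 < (ζ - ζ⁻¹).im := by rw [e2]; positivity
  have hn : 0 < Complex.normSq (ζ - ζ⁻¹) := by
    apply Complex.normSq_pos.2
    intro h; rw [h] at hpos; simp at hpos
  rw [e1, Complex.im_ofReal_mul, Complex.inv_im]
  have : 0 < (ζ - ζ⁻¹).im / Complex.normSq (ζ - ζ⁻¹) := by positivity
  rw [neg_div]; linarith

lemma kap_pos (θ : ℝ) (hθ0 : 0 < θ) (hθ1 : θ ≤ 1) : 0 < kap θ := by
  have hi := integrable_kerK θ hθ0 hθ1
  have e : kap θ = ∫ x : ℝ, -(kerK θ x).im := by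
    rw [kap, integral_neg]
    congr 1
    exact ((Complex.imCLM.integral_comp_comm hi).symm)
  rw [e, integral_pos_iff_support_of_nonneg]
  · have : Function.support (fun x : ℝ => -(kerK θ x).im) = Set.univ := by
      ext x; simp [(kerK_im_neg θ hθ0 hθ1 x).ne]
    rw [this]; simp
  · intro x; simpa using (kerK_im_neg θ hθ0 hθ1 x).le
  · exact (Complex.imCLM.integrable_comp hi).neg

lemma key_identity (g : ℂ → ℂ) (hg : Differentiable ℂ g) (θ M : ℝ) (hθ0 : 0 < θ) (hθ1 : θ ≤ 1)
    (hM0 : 0 ≤ M)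
    (hM : ∀ x v : ℝ, 0 ≤ v → v ≤ θ → ‖g (Complex.exp (x + v * I))‖ ≤ M / (1 + Real.exp (2 * x)))
    (hreal : ∀ x : ℝ, (g x).im = 0) (T : ℝ) (hT : 1 ≤ T) :
    (∫ x : ℝ, g (Complex.exp (x + θ * I)) * Complex.exp (x + θ * I) / (T - Complex.exp (x + θ * I))).im
      = kap θ * (g T).re := by
  have hs : 0 < Real.sin θ := Real.sin_pos_of_pos_of_lt_pi (by linarith) (by linarith [Real.pi_gt_three])
  have hT0 : 0 < T := by linarith
  have hTC : (T : ℂ) ≠ 0 := by exact_mod_cast hT0.ne'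
  set h : ℂ → ℂ := fun ζ => dslope g T ζ + g T / (ζ + T) with hh
  set H : ℂ → ℂ := fun w => h (Complex.exp w) * Complex.exp w with hH
  have hds : Differentiable ℂ (dslope g (T : ℂ)) := by
    rw [← differentiableOn_univ]
    exact (Complex.differentiableOn_dslope Filter.univ_mem).2 hg.differentiableOn
  have hcospos : ∀ v : ℝ, 0 ≤ v → v ≤ θ → 0 < Real.cos v := by
    intro v h0 h1
    exact Real.cos_pos_of_mem_Ioo ⟨by linarith [Real.pi_gt_three], by linarith [Real.pi_gt_three]⟩
  have hne : ∀ w : ℂ, 0 ≤ w.im → w.im ≤ θ → Complex.exp w + T ≠ 0 := by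
    intro w h0 h1 h2
    have := congrArg Complex.re h2
    rw [Complex.add_re, Complex.exp_re, Complex.ofReal_re, Complex.zero_re] at this
    have h3 := hcospos _ h0 h1
    have : 0 < Real.exp w.re * Real.cos w.im := by positivity
    linarith
  have hHeq : ∀ w : ℂ, 0 ≤ w.im → w.im ≤ θ → Complex.exp w ≠ T →
      H w = g (Complex.exp w) * Complex.exp w / (Complex.exp w - T)
        - 2 * T * Complex.exp w / (Complex.exp w ^ 2 - T ^ 2) * g T := by
    intro w h0 h1 h2
    have h3 := hne w h0 h1
    have h4 : Complex.exp w - T ≠ 0 := sub_ne_zero.2 h2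
    have h5 : Complex.exp w ^ 2 - (T : ℂ) ^ 2 ≠ 0 := by
      rw [sq_sub_sq]; exact mul_ne_zero h3 h4
    simp only [hH, hh]
    rw [dslope_of_ne _ h2, slope_def_field]
    rw [sq_sub_sq]
    field_simp
    ring
  have hbound : ∀ x v : ℝ, 0 ≤ v → v ≤ θ → Real.exp x ≠ T →
      ‖H (x + v * I)‖ ≤ M / (1 + Real.exp (2 * x)) * Real.exp x / |Real.exp x - T|
        + 2 * T * Real.exp x / |Real.exp (2 * x) - T ^ 2| * ‖g T‖ := by
    intro x v h0 h1 h2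
    have hn := norm_exp_xv x v
    have h3 : Complex.exp (x + v * I) ≠ T := by
      intro h; rw [h, Complex.norm_real, Real.norm_of_nonneg hT0.le] at hn
      exact h2 hn.symm
    rw [hHeq _ (by simpa using h0) (by simpa using h1) h3]
    refine (norm_sub_le _ _).trans ?_
    have a1 : |Real.exp x - T| ≤ ‖Complex.exp (x + v * I) - T‖ := by
      have := abs_norm_sub_norm_le (Complex.exp (x + v * I)) (T : ℂ)
      rwa [hn, Complex.norm_real, Real.norm_of_nonneg hT0.le] at this
    have hE2 : Real.exp (2 * x) = Real.exp x ^ 2 := by rw [← Real.exp_nat_mul]; norm_num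
    have a2 : |Real.exp (2 * x) - T ^ 2| ≤ ‖Complex.exp (x + v * I) ^ 2 - (T : ℂ) ^ 2‖ := by
      have := abs_norm_sub_norm_le (Complex.exp (x + v * I) ^ 2) ((T : ℂ) ^ 2)
      rwa [norm_pow, norm_pow, hn, Complex.norm_real, Real.norm_of_nonneg hT0.le, ← hE2] at this
    have b1 : 0 < |Real.exp x - T| := abs_pos.2 (sub_ne_zero.2 h2)
    have b2 : 0 < |Real.exp (2 * x) - T ^ 2| := by
      rw [hE2, sq_sub_sq]
      apply abs_pos.2 (mul_ne_zero (by positivity) (sub_ne_zero.2 h2))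
    simp only [norm_mul, norm_div, hn, Complex.norm_ofNat, Complex.norm_real,
      Real.norm_of_nonneg hT0.le]
    have := hM x v h0 h1
    gcongr
  have hintf1 : Integrable fun x : ℝ => g (Complex.exp (x + θ * I)) * Complex.exp (x + θ * I) / (Complex.exp (x + θ * I) - T) := by
    refine Integrable.mono' (integrable_E.const_mul (M / Real.sin θ)) ?_ ?_
    · apply Measurable.aestronglyMeasurable
      have : Measurable g := hg.continuous.measurable
      fun_prop
    · refine Filter.Eventually.of_forall fun x => ?_
      have h1 := ray_sub_lower θ (Real.exp x) T
      rw [← exp_xv, abs_of_pos (by positivity)] at h1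
      have h2 : Real.sin θ ≤ ‖Complex.exp (x + θ * I) - T‖ := by nlinarith
      rw [norm_div, norm_mul, norm_exp_xv]
      calc _ ≤ M / (1 + Real.exp (2 * x)) * Real.exp x / Real.sin θ := by
            gcongr
            exact hM x θ hθ0.le le_rfl
        _ = _ := by ring
  have hshift : ∀ x : ℝ, 2 * T * Complex.exp (x + θ * I) / (Complex.exp (x + θ * I) ^ 2 - T ^ 2)
      = kerK θ (x - Real.log T) := by
    intro x
    have e : Complex.exp (((x - Real.log T : ℝ) : ℂ) + θ * I) = Complex.exp (x + θ * I) / T := by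
      have : ((x - Real.log T : ℝ) : ℂ) + θ * I = (x + θ * I) - ((Real.log T : ℝ) : ℂ) := by
        push_cast; ring
      rw [this, Complex.exp_sub, ← Complex.ofReal_exp, Real.exp_log hT0]
    rw [kerK, e]
    rw [show (Complex.exp (x + θ * I) / T) ^ 2 - 1 = (Complex.exp (x + θ * I) ^ 2 - T ^ 2) / T ^ 2 by
      field_simp]
    rw [div_div_eq_mul_div]
    congr 1
    field_simp
  have hHθ : ∀ x : ℝ, H (x + θ * I) = g (Complex.exp (x + θ * I)) * Complex.exp (x + θ * I) / (Complex.exp (x + θ * I) - T)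
      - kerK θ (x - Real.log T) * g T := by
    intro x
    rw [← hshift]
    apply hHeq
    · simpa using hθ0.le
    · simp
    · intro hc
      have h1 := ray_sub_lower θ (Real.exp x) T
      rw [← exp_xv, hc, sub_self, norm_zero, abs_of_pos (by positivity)] at h1
      have : 0 < T * Real.sin θ := by positivity
      linarith
  have hik : Integrable fun x : ℝ => kerK θ (x - Real.log T) * g T :=
    ((integrable_kerK θ hθ0 hθ1).comp_sub_right _).mul_const _
  have hz := strip_im_zero H θ (2 * M + 4 * T * ‖g T‖) (Real.log (2 * T)) hθ0.le
    (by
      intro w h0 h1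
      have := hne w h0 h1
      simp only [hH, hh]
      have d1 : DifferentiableAt ℂ (fun w => dslope g (T : ℂ) (Complex.exp w)) w :=
        (hds _).comp w Complex.differentiableAt_exp
      have d2 : DifferentiableAt ℂ (fun w => g T / (Complex.exp w + T)) w :=
        (differentiableAt_const _).div (by fun_prop) this
      exact (d1.add d2).mul Complex.differentiableAt_exp)
    (by
      intro x v hx h0 h1
      have hE2 : Real.exp (2 * x) = Real.exp x ^ 2 := by rw [← Real.exp_nat_mul]; norm_num
      have hx0 : 2 * T ≤ Real.exp |x| := by
        rw [← Real.log_le_iff_le_exp (by positivity)]; exact hx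
      have hEpos := Real.exp_pos x
      rcases le_or_gt 0 x with hx1 | hx1
      · rw [abs_of_nonneg hx1] at hx0 ⊢
        have c1 : Real.exp x / 2 ≤ |Real.exp x - T| := by
          rw [abs_of_nonneg (by linarith)]; linarith
        have c2 : Real.exp x ^ 2 / 2 ≤ |Real.exp (2 * x) - T ^ 2| := by
          rw [hE2, abs_of_nonneg (by nlinarith)]; nlinarith
        refine (hbound x v h0 h1 (by linarith)).trans ?_
        calc _ ≤ M / (Real.exp x) * Real.exp x / (Real.exp x / 2) + 2 * T * Real.exp x / (Real.exp x ^ 2 / 2) * ‖g T‖ := by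
              gcongr
              rw [hE2]; nlinarith
          _ = _ := by rw [Real.exp_neg]; field_simp; ring
      · rw [abs_of_neg hx1] at hx0 ⊢
        rw [neg_neg]
        have hle : Real.exp x ≤ 1 / 2 := by
          rw [Real.exp_neg] at hx0
          have : Real.exp x * (Real.exp x)⁻¹ = 1 := mul_inv_cancel₀ hEpos.ne'
          nlinarith
        have c1 : 1 / 2 ≤ |Real.exp x - T| := by
          rw [abs_of_neg (by linarith)]; linarith
        have c2 : 1 / 2 ≤ |Real.exp (2 * x) - T ^ 2| := by
          rw [hE2, abs_of_neg (by nlinarith)]; nlinarith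
        refine (hbound x v h0 h1 (by linarith)).trans ?_
        calc _ ≤ M / 1 * Real.exp x / (1 / 2) + 2 * T * Real.exp x / (1 / 2) * ‖g T‖ := by
              gcongr
              linarith [Real.exp_pos (2 * x)]
          _ = _ := by ring)
    (by
      have : ∀ᵐ x : ℝ, x ≠ Real.log T := by
        simp [ae_iff, measure_singleton]
      filter_upwards [this] with x hx
      have hx' : Complex.exp x ≠ T := by
        rw [← Complex.ofReal_exp]
        intro hc
        apply hx
        have : Real.exp x = T := by exact_mod_cast hc
        rw [← this, Real.log_exp]
      rw [hHeq x (by simp) (by simpa using hθ0.le) hx', ← Complex.ofReal_exp]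
      have g1 : ∀ y : ℝ, g y = (((g y).re : ℝ) : ℂ) := fun y => by
        apply Complex.ext <;> simp [hreal]
      rw [g1, g1 T]
      norm_cast)
    (by
      simp_rw [hHθ]
      exact hintf1.sub hik)
  simp_rw [hHθ] at hz
  rw [integral_sub hintf1 hik, integral_mul_const, integral_sub_right_eq_self (kerK θ),
    Complex.sub_im, Complex.mul_im, hreal T, mul_zero, zero_add] at hz
  have e : ∫ x : ℝ, g (Complex.exp (x + θ * I)) * Complex.exp (x + θ * I) / (T - Complex.exp (x + θ * I))
     = -∫ x : ℝ, g (Complex.exp (x + θ * I)) * Complex.exp (x + θ * I) / (Complex.exp (x + θ * I) - T) := by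
    rw [← integral_neg]
    congr 1; funext x
    rw [← div_neg, neg_sub]
  rw [e, Complex.neg_im, kap]
  linarith

open ComplexConjugate in
lemma abstract_repr (q : ℕ) (hq : 1 ≤ q) : ∃ (ν : Measure (ℝ × ℝ × ℝ)) (G Λ : ℝ × ℝ × ℝ → ℂ) (K : ℝ),
    Integrable G ν ∧ AEStronglyMeasurable Λ ν ∧ 1 ≤ K ∧ (∀ᵐ x ∂ν, ‖Λ x‖ ≤ K * (Λ x).re) ∧
    ∀ t : ℝ, 0 ≤ t → phiq q t = (∫ x, G x * Complex.exp (-(Λ x * (t : ℝ))) ∂ν).im := by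
  obtain ⟨θ, hθ0, hθ1, M, hM0, hM⟩ := psi_bound q hq
  have hs : 0 < Real.sin θ := Real.sin_pos_of_pos_of_lt_pi (by linarith) (by linarith [Real.pi_gt_three])
  have hκ := kap_pos θ hθ0 hθ1
  set a : ℂ := I * Complex.exp ((-θ : ℝ) * I) with ha
  have hare : a.re = Real.sin θ := by
    rw [ha, Complex.I_mul_re, Complex.exp_ofReal_mul_I_im, Real.sin_neg, neg_neg]
  have han : ‖a‖ = 1 := by
    rw [ha, norm_mul, Complex.norm_I, Complex.norm_exp_ofReal_mul_I, one_mul]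
  have ha0 : a ≠ 0 := by rw [← norm_pos_iff, han]; norm_num
  have haζ : ∀ x : ℝ, a * Complex.exp (x + θ * I) = I * (Real.exp x : ℝ) := by
    intro x
    rw [ha, mul_assoc, ← Complex.exp_add, Complex.ofReal_exp]
    congr 2; push_cast; ring
  set c0 : ℝ := 1 / Aq q * (1 / kap θ) with hc0
  set ν3 : Measure ℝ := volume.restrict (Set.Ioi 0) with hν3
  set ν : Measure (ℝ × ℝ × ℝ) := volume.prod (volume.prod ν3) with hν
  set G : ℝ × ℝ × ℝ → ℂ := fun p => (c0 : ℂ) * (psi q p.1 (Complex.exp (p.2.1 + θ * I)) *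
    Complex.exp (p.2.1 + θ * I) * a * Complex.exp (-(a * (1 - Complex.exp (p.2.1 + θ * I))) * p.2.2)) with hG
  set Λ : ℝ × ℝ × ℝ → ℂ := fun p => a * p.2.2 with hΛ
  have hGm : Measurable G := by
    apply Continuous.measurable
    rw [hG]; unfold psi
    fun_prop
  have hpos : ∀ᵐ p ∂ν, 0 < p.2.2 := by
    have h3 : ∀ᵐ r ∂ν3, 0 < r := by
      rw [hν3]; exact ae_restrict_mem measurableSet_Ioi
    have h23 : ∀ᵐ y ∂((volume : Measure ℝ).prod ν3), 0 < y.2 :=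
      Measure.quasiMeasurePreserving_snd.ae h3
    exact Measure.quasiMeasurePreserving_snd.ae h23
  have hGi : Integrable G ν := by
    have i3 : Integrable (fun r : ℝ => Real.exp (-Real.sin θ * r)) ν3 :=
      integrableOn_exp_mul_Ioi (by linarith) 0
    have i23 := integrable_E.mul_prod i3
    have i1 : Integrable (fun s : ℝ => Real.exp (-(1/2) * s ^ 2)) := integrable_exp_neg_mul_sq (by norm_num)
    have i123 := (i1.mul_prod i23).const_mul (|c0| * M)
    refine Integrable.mono' i123 hGm.aestronglyMeasurable ?_
    refine Filter.Eventually.of_forall fun p => ?_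
    obtain ⟨s, x, r⟩ := p
    simp only [hG, norm_mul, norm_exp_xv, han, Complex.norm_real, Real.norm_eq_abs]
    have e : ‖Complex.exp (-(a * (1 - Complex.exp (x + θ * I))) * r)‖ = Real.exp (-Real.sin θ * r) := by
      rw [Complex.norm_exp, Complex.re_mul_ofReal, mul_sub, haζ, Complex.neg_re, Complex.sub_re, mul_one, hare]
      simp
    rw [e]
    calc _ ≤ |c0| * (M * Real.exp (-(1/2) * s ^ 2) / (1 + Real.exp (2 * x)) * Real.exp x * 1 * Real.exp (-Real.sin θ * r)) := by
          gcongr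
          exact hM s x θ hθ0.le le_rfl
      _ = _ := by ring
  refine ⟨ν, G, Λ, 1 / Real.sin θ, hGi, ?_, ?_, ?_, ?_⟩
  · apply Continuous.aestronglyMeasurable
    rw [hΛ]; fun_prop
  · rw [le_div_iff₀ hs, one_mul]; exact Real.sin_le_one θ
  · filter_upwards [hpos] with p hp
    simp only [hΛ]
    rw [norm_mul, han, Complex.re_mul_ofReal, hare, Complex.norm_real, Real.norm_of_nonneg hp.le]
    apply le_of_eq; field_simp
  intro t ht
  set T : ℝ := t + 1 with hT
  have hT1 : 1 ≤ T := by linarith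
  set f : ℝ × ℝ × ℝ → ℂ := fun p => G p * Complex.exp (-(Λ p * (t : ℝ))) with hf
  have hfi : Integrable f ν := by
    refine hGi.mul_bdd (c := 1) ?_ ?_
    · apply Continuous.aestronglyMeasurable
      rw [hΛ]; fun_prop
    · filter_upwards [hpos] with p hp
      simp only [hΛ]
      rw [Complex.norm_exp, Complex.neg_re, Complex.re_mul_ofReal, Complex.re_mul_ofReal, hare]
      apply Real.exp_le_one_iff.2
      have : 0 ≤ Real.sin θ * p.2.2 * t := by positivity
      linarith
  have hfe : ∀ s x r : ℝ, f (s, x, r) = ((c0 : ℂ) * (psi q s (Complex.exp (x + θ * I)) *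
      Complex.exp (x + θ * I) * a)) * Complex.exp (-(a * (T - Complex.exp (x + θ * I))) * r) := by
    intro s x r
    simp only [hf, hG, hΛ]
    rw [mul_assoc, mul_assoc, mul_assoc (c0 : ℂ), ← Complex.exp_add]
    congr 4
    rw [hT]; push_cast; ring
  have hr : ∀ s x : ℝ, ∫ r, f (s, x, r) ∂ν3 = (c0 : ℂ) * (psi q s (Complex.exp (x + θ * I)) *
      Complex.exp (x + θ * I) / (T - Complex.exp (x + θ * I))) := by
    intro s x
    simp_rw [hfe]
    have hre : (a * (T - Complex.exp (x + θ * I))).re = Real.sin θ * T := by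
      rw [mul_sub, haζ, Complex.sub_re, Complex.re_mul_ofReal, hare]; simp
    have hre0 : 0 < (a * (T - Complex.exp (x + θ * I))).re := by rw [hre]; positivity
    have hne : (T : ℂ) - Complex.exp (x + θ * I) ≠ 0 := by
      intro h; rw [h] at hre0; simp at hre0
    rw [integral_const_mul, hν3, integral_exp_mul_complex_Ioi (by rw [Complex.neg_re]; linarith)]
    simp only [Complex.ofReal_zero, mul_zero, Complex.exp_zero]
    field_simp
  rw [show (∫ x, G x * Complex.exp (-(Λ x * (t : ℝ))) ∂ν) = ∫ p, f p ∂ν from rfl]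
  rw [hν] at hfi ⊢
  rw [integral_prod f hfi]
  have hJ : Integrable (fun s : ℝ => ∫ y, f (s, y) ∂(volume.prod ν3)) := hfi.integral_prod_left
  have him : (∫ s : ℝ, ∫ y, f (s, y) ∂(volume.prod ν3)).im
      = ∫ s : ℝ, (∫ y, f (s, y) ∂(volume.prod ν3)).im :=
    (Complex.imCLM.integral_comp_comm hJ).symm
  rw [him, phiq, ← integral_const_mul]
  apply integral_congr_ae
  filter_upwards [hfi.prod_right_ae] with s hsi
  rw [integral_prod _ hsi]
  simp_rw [hr s]
  rw [integral_const_mul, Complex.im_ofReal_mul]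
  have hpsid : Differentiable ℂ (psi q s) := by unfold psi; fun_prop
  have hpsir : ∀ x : ℝ, psi q s x = ((Real.exp (-(s ^ (2 * q)) - (x - 1 - s) ^ (2 * q)) : ℝ) : ℂ) := by
    intro x; rw [psi]; push_cast; rfl
  rw [key_identity (psi q s) hpsid θ (M * Real.exp (-(1/2) * s ^ 2)) hθ0 hθ1 (by positivity)
    (fun x v h0 h1 => hM s x v h0 h1) (fun x => by rw [hpsir, Complex.ofReal_im]) T hT1]
  rw [hpsir, Complex.ofReal_re, hc0]
  have : T - 1 - s = t - s := by rw [hT]; ring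
  rw [this]
  field_simp

lemma phiq_decay (q : ℕ) (hq : 1 ≤ q) : ∃ B : ℝ, 0 ≤ B ∧ ∀ t : ℝ, |phiq q t| ≤ B * Real.exp (-(t ^ 2 / 4)) := by
  have i1 : Integrable (fun s : ℝ => Real.exp (-(1/2) * s ^ 2)) := integrable_exp_neg_mul_sq (by norm_num)
  refine ⟨|1 / Aq q| * (Real.exp 2 * ∫ s : ℝ, Real.exp (-(1/2) * s ^ 2)), ?_, fun t => ?_⟩
  · have : 0 ≤ ∫ s : ℝ, Real.exp (-(1/2) * s ^ 2) := integral_nonneg fun s => (Real.exp_pos _).le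
    positivity
  rw [phiq, abs_mul, mul_assoc]
  gcongr
  have h : ‖∫ s : ℝ, Real.exp (-(s ^ (2 * q)) - (t - s) ^ (2 * q))‖
      ≤ ∫ s : ℝ, Real.exp (-(1/2) * s ^ 2) * (Real.exp 2 * Real.exp (-(t ^ 2 / 4))) := by
    refine norm_integral_le_of_norm_le (i1.mul_const _) (Filter.Eventually.of_forall fun s => ?_)
    rw [Real.norm_of_nonneg (Real.exp_pos _).le, ← Real.exp_add, ← Real.exp_add]
    apply Real.exp_le_exp.2
    have h1 := pow_ge_sq q hq s
    have h2 := pow_ge_sq q hq (t - s)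
    nlinarith [sq_nonneg (3 * s - 2 * t), sq_nonneg t]
  rw [integral_mul_const, Real.norm_eq_abs] at h
  refine h.trans (le_of_eq (by ring))

lemma phiq_summable (q : ℕ) (hq : 1 ≤ q) (ε : ℝ) (hε : 0 < ε) (R : ℝ) :
    Summable fun n : ℕ => ‖(phiq q ((n + 1) * ε) : ℂ)‖ * R ^ n := by
  obtain ⟨B, hB0, hB⟩ := phiq_decay q hq
  set L : ℝ := Real.log (2 * (|R| + 1)) with hL
  have hR2 : 0 < 2 * (|R| + 1) := by positivity
  have hgeo : Summable fun n : ℕ => B * Real.exp ((L / ε) ^ 2) * (1 / 2 : ℝ) ^ n :=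
    (summable_geometric_of_lt_one (by norm_num) (by norm_num)).mul_left _
  refine Summable.of_norm_bounded hgeo fun n => ?_
  rw [norm_mul, norm_norm, Complex.norm_real, Real.norm_eq_abs, norm_pow, Real.norm_eq_abs]
  set t : ℝ := (n + 1) * ε with ht
  have h1 : -(t ^ 2 / 4) ≤ (L / ε) ^ 2 + -((n + 1 : ℕ) * L) := by
    have : (L / ε) * t = (n + 1 : ℕ) * L := by rw [ht]; push_cast; field_simp
    rw [← this]
    nlinarith [sq_nonneg (t / 2 - L / ε)]
  have h2 : Real.exp (-((n + 1 : ℕ) * L)) = ((2 * (|R| + 1)) ^ (n + 1))⁻¹ := by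
    rw [Real.exp_neg, Real.exp_nat_mul, hL, Real.exp_log hR2]
  have h3 : |R| ^ n * ((2 * (|R| + 1)) ^ (n + 1))⁻¹ ≤ (1 / 2) ^ n := by
    rw [← div_eq_mul_inv, div_le_iff₀ (by positivity), mul_pow, one_div, inv_pow, pow_succ 2, ]
    have : ((2 : ℝ) ^ n)⁻¹ * (2 ^ n * 2 * (|R| + 1) ^ (n + 1)) = 2 * (|R| + 1) ^ (n + 1) := by
      field_simp
    rw [this]
    have h5 : |R| ^ n ≤ (|R| + 1) ^ (n + 1) := by
      calc |R| ^ n ≤ (|R| + 1) ^ n := by gcongr; linarith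
        _ ≤ (|R| + 1) ^ (n + 1) := pow_le_pow_right₀ (by linarith [abs_nonneg R]) (by omega)
    have : 0 ≤ (|R| + 1) ^ (n + 1) := by positivity
    linarith
  calc |phiq q t| * |R| ^ n ≤ (B * Real.exp (-(t ^ 2 / 4))) * |R| ^ n := by gcongr; exact hB t
    _ ≤ (B * Real.exp ((L / ε) ^ 2 + -((n + 1 : ℕ) * L))) * |R| ^ n := by gcongr
    _ = B * Real.exp ((L / ε) ^ 2) * (|R| ^ n * ((2 * (|R| + 1)) ^ (n + 1))⁻¹) := by
        rw [Real.exp_add, h2]; ring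
    _ ≤ _ := by gcongr

open Filter Topology ComplexConjugate in
lemma Seps_deriv_bound_aux (q : ℕ) (hq : 1 ≤ q) :
    ∃ C > (0 : ℝ), ∀ ε : ℝ, 0 < ε → ∀ j : ℕ, ∀ z : ℂ, ‖z‖ ≤ 1 → z ≠ 1 →
      ‖iteratedDerivWithin j (Seps q ε) (closedBall (0 : ℂ) 1) z‖
        ≤ (C / ‖1 - z‖) ^ (j + 1) * j.factorial := by
  obtain ⟨ν, G, Λ, K, hG, hΛm, hK, hΛ, hrep⟩ := abstract_repr q hq
  set N : ℝ := ∫ x, ‖G x‖ ∂ν with hN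
  have hN0 : 0 ≤ N := integral_nonneg fun x => norm_nonneg _
  refine ⟨(N + 1) * (1 + 2 * K), by positivity, ?_⟩
  intro ε hε j z hz hz1
  set a : ℕ → ℂ := fun n => (phiq q ((n + 1) * ε) : ℂ) with ha
  have hsum : ∀ R : ℝ, Summable fun n => ‖a n‖ * R ^ n := fun R => phiq_summable q hq ε hε R
  have hS : Seps q ε = fun z => ∑' n : ℕ, a n * z ^ n := by
    funext z; rfl
  have hdiff : Differentiable ℂ (Seps q ε) := by
    rw [hS]; exact fun z => (ps_hasDerivAt a hsum z).differentiableAt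
  have hcd : ContDiff ℂ j (Seps q ε) := hdiff.contDiff
  have hud : UniqueDiffOn ℂ (closedBall (0 : ℂ) 1) :=
    uniqueDiffOn_convex_of_isRCLikeNormedField (convex_closedBall (0 : ℂ) 1) ⟨0, by simp [interior_closedBall]⟩
  rw [iteratedDerivWithin_eq_iteratedDeriv hud hcd.contDiffAt (by simpa using hz)]
  have hcont : Continuous (iteratedDeriv j (Seps q ε)) := hcd.continuous_iteratedDeriv j le_rfl
  -- the bound in the open disc
  have hopen : ∀ w : ℂ, ‖w‖ < 1 → ‖iteratedDeriv j (Seps q ε) w‖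
      ≤ ((N + 1) * (1 + 2 * K) / ‖1 - w‖) ^ (j + 1) * j.factorial := by
    intro w hw
    rw [hS, ps_iteratedDeriv a hsum j]
    obtain ⟨s1, b1⟩ := abstract_bound ν G Λ hG hΛm K hK hΛ ε hε j w hw
    obtain ⟨s2, b2⟩ := abstract_bound ν (fun x => conj (G x)) (fun x => conj (Λ x))
      (hG.congr' (f := G) (g := fun x => conj (G x)) (Complex.continuous_conj.comp_aestronglyMeasurable hG.1)
        (by simp)) (Complex.continuous_conj.comp_aestronglyMeasurable hΛm) K hK
      (by filter_upwards [hΛ] with x hx; simpa using hx) ε hε j w hw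
    have e : ∀ n : ℕ, (((n + j).descFactorial j : ℂ) * a (n + j)) * w ^ n
        = ((((n + j).descFactorial j : ℂ) *
        ∫ x, G x * Complex.exp (-(Λ x * (((n + j : ℕ) + 1 : ℝ) * ε : ℝ))) ∂ν) * w ^ n
        - (((n + j).descFactorial j : ℂ) *
        ∫ x, conj (G x) * Complex.exp (-(conj (Λ x) * (((n + j : ℕ) + 1 : ℝ) * ε : ℝ))) ∂ν) * w ^ n)
          * (1 / (2 * I)) := by
      intro n
      have h1 := hrep (((n + j : ℕ) + 1 : ℝ) * ε) (by positivity)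
      have h2 : ∫ x, conj (G x) * Complex.exp (-(conj (Λ x) * (((n + j : ℕ) + 1 : ℝ) * ε : ℝ))) ∂ν
          = conj (∫ x, G x * Complex.exp (-(Λ x * (((n + j : ℕ) + 1 : ℝ) * ε : ℝ))) ∂ν) := by
        rw [← integral_conj]
        congr 1; funext x
        rw [map_mul, ← Complex.exp_conj, map_neg, map_mul, Complex.conj_ofReal]
      rw [h2]
      have h3 : a (n + j) = (phiq q (((n + j : ℕ) + 1 : ℝ) * ε) : ℂ) := rfl
      rw [h3, h1, Complex.im_eq_sub_conj]
      ring
    simp_rw [e]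
    rw [tsum_mul_right, s1.tsum_sub s2, norm_mul]
    have hnI : ‖(1 / (2 * I) : ℂ)‖ = 1 / 2 := by simp
    rw [hnI]
    have hb := norm_sub_le
      (∑' n : ℕ, (((n + j).descFactorial j : ℂ) *
        ∫ x, G x * Complex.exp (-(Λ x * (((n + j : ℕ) + 1 : ℝ) * ε : ℝ))) ∂ν) * w ^ n)
      (∑' n : ℕ, (((n + j).descFactorial j : ℂ) *
        ∫ x, conj (G x) * Complex.exp (-(conj (Λ x) * (((n + j : ℕ) + 1 : ℝ) * ε : ℝ))) ∂ν) * w ^ n)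
    simp only [RCLike.norm_conj] at b2
    rw [← hN] at b1 b2
    have hfin : N * (((1 + 2 * K) / ‖1 - w‖) ^ (j + 1) * j.factorial)
        ≤ ((N + 1) * (1 + 2 * K) / ‖1 - w‖) ^ (j + 1) * j.factorial := by
      rw [mul_div_assoc, mul_pow (N + 1), ← mul_assoc]
      have : N ≤ (N + 1) ^ (j + 1) := by
        have := le_self_pow₀ (show 1 ≤ N + 1 by linarith) (show j + 1 ≠ 0 by omega)
        linarith
      gcongr
    linarith
  -- radial limit
  have hpath : Tendsto (fun r : ℝ => (r : ℂ) * z) (𝓝[<] 1) (𝓝 z) := by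
    have : Continuous fun r : ℝ => (r : ℂ) * z := by fun_prop
    have h := this.tendsto 1
    simp only [Complex.ofReal_one, one_mul] at h
    exact h.mono_left nhdsWithin_le_nhds
  have hL := ((hcont.norm.tendsto z).comp hpath)
  have hne : ‖1 - z‖ ≠ 0 := norm_ne_zero_iff.2 (sub_ne_zero.2 hz1.symm)
  have hRt : Tendsto (fun r : ℝ => ((N + 1) * (1 + 2 * K) / ‖1 - (r : ℂ) * z‖) ^ (j + 1) * (j.factorial : ℝ))
      (𝓝[<] 1) (𝓝 (((N + 1) * (1 + 2 * K) / ‖1 - z‖) ^ (j + 1) * (j.factorial : ℝ))) := by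
    refine Tendsto.mul_const _ (Tendsto.pow ?_ _)
    exact Tendsto.div tendsto_const_nhds (hpath.const_sub 1).norm hne
  refine le_of_tendsto_of_tendsto hL hRt ?_
  filter_upwards [Ioo_mem_nhdsLT (show (0 : ℝ) < 1 by norm_num)] with r hr
  apply hopen
  rw [norm_mul, Complex.norm_real, Real.norm_of_nonneg hr.1.le]
  nlinarith [hr.1, hr.2, norm_nonneg z]

/-- Uniformly in `ε > 0`: for `|z| ≤ 1`, `z ≠ 1`, the derivatives of `S_ε` satisfy
`|S_ε^{(j)}(z)| ≤ (C/|1−z|)^{j+1}·j!`. -/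
theorem Seps_deriv_bound (q : ℕ) (hq : 1 ≤ q) :
    ∃ C > (0 : ℝ), ∀ ε : ℝ, 0 < ε → ∀ j : ℕ, ∀ z : ℂ, ‖z‖ ≤ 1 → z ≠ 1 →
      ‖iteratedDerivWithin j (Seps q ε) (closedBall (0 : ℂ) 1) z‖
        ≤ (C / ‖1 - z‖) ^ (j + 1) * j.factorial := by
  exact Seps_deriv_bound_aux q hq
end
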